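/- arXiv:1906.01469 — 3 statements merged into one kernel-verified Lean document; each statement's English description precedes it below -/
import Mathlib

section
/- A full-dimensional lattice polytope P ⊂ ℝ^d is compressed (every pulling triangulation is unimodular) if and only if it has facet width one, i.e., for each facet-defining inequality ⟨a,x⟩ ≤ b with a primitive integral, max_{p∈P}⟨a,p⟩ − min_{p∈P}⟨a,p⟩ = 1. -/
open Finset

/-- Dot product on `ℝ^d`. -/
def dot {d : ℕ} (x y : Fin d → ℝ) : ℝ := ∑ i, x i * y i

/-- Coordinatewise absolute value. -/
def absVec {d : ℕ} (p : Fin d → ℝ) : Fin d → ℝ := fun i => |p i|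

/-- A vector of signs `±1`. -/
def IsSignVec {d : ℕ} (σ : Fin d → ℝ) : Prop := ∀ i, σ i = 1 ∨ σ i = -1

/-- Coordinatewise sign flip. -/
def sflip {d : ℕ} (σ p : Fin d → ℝ) : Fin d → ℝ := fun i => σ i * p i

/-- A set is unconditional if it is closed under coordinate sign flips. -/
def Unconditional {d : ℕ} (K : Set (Fin d → ℝ)) : Prop :=
  ∀ σ : Fin d → ℝ, IsSignVec σ → ∀ p ∈ K, sflip σ p ∈ K

/-- A (nonempty) polytope: the convex hull of a nonempty finite set. -/
def IsPolytope {d : ℕ} (P : Set (Fin d → ℝ)) : Prop :=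
  ∃ V : Finset (Fin d → ℝ), V.Nonempty ∧ P = convexHull ℝ (V : Set (Fin d → ℝ))

/-- The nonnegative orthant of `ℝ^d`. -/
def nonnegOrthant (d : ℕ) : Set (Fin d → ℝ) := {x | ∀ i, 0 ≤ x i}

/-- An anti-blocking polytope: a polytope in the nonnegative orthant that is
down-closed with respect to the componentwise order. -/
def IsAntiBlocking {d : ℕ} (P : Set (Fin d → ℝ)) : Prop :=
  IsPolytope P ∧ P ⊆ nonnegOrthant d ∧
    ∀ q ∈ P, ∀ p : Fin d → ℝ, (∀ i, 0 ≤ p i ∧ p i ≤ q i) → p ∈ P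

/-- The unconditional set associated to a set `P`: all points whose vector of
absolute values lies in `P`. -/
def UPoly {d : ℕ} (P : Set (Fin d → ℝ)) : Set (Fin d → ℝ) := {p | absVec p ∈ P}

/-- Cast an integer vector to a real vector. -/
def intCast {d : ℕ} (a : Fin d → ℤ) : Fin d → ℝ := fun i => (a i : ℝ)

/-- A lattice polytope: convex hull of a nonempty finite set of integer points. -/
def IsLatticePolytope {d : ℕ} (P : Set (Fin d → ℝ)) : Prop :=
  ∃ V : Finset (Fin d → ℤ), V.Nonempty ∧ P = convexHull ℝ (intCast '' (V : Set (Fin d → ℤ)))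

/-- Reflexive polytope: `0` is interior and `P` is cut out by integral
inequalities with right-hand side `1`. -/
def IsReflexive {d : ℕ} (P : Set (Fin d → ℝ)) : Prop :=
  0 ∈ interior P ∧
    ∃ A : Finset (Fin d → ℤ), P = {x | ∀ a ∈ A, dot (intCast a) x ≤ 1}

/-- A facet-defining valid inequality. -/
def IsFacetIneq {d : ℕ} (Q : Set (Fin d → ℝ)) (a : Fin d → ℤ) (b : ℝ) : Prop :=
  (∀ x ∈ Q, dot (intCast a) x ≤ b) ∧
    Module.finrank ℝ (vectorSpan ℝ {x | x ∈ Q ∧ dot (intCast a) x = b}) = d - 1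

/-- Facet width one. -/
def HasFacetWidthOne {d : ℕ} (Q : Set (Fin d → ℝ)) : Prop :=
  ∀ (a : Fin d → ℤ) (b : ℝ), Finset.univ.gcd a = 1 → IsFacetIneq Q a b →
    sSup ((fun x => dot (intCast a) x) '' Q) -
      sInf ((fun x => dot (intCast a) x) '' Q) = 1

/-- `F` is a face of `P`: the locus of equality of a valid linear inequality. -/
def IsFaceOf {d : ℕ} (F P : Set (Fin d → ℝ)) : Prop :=
  ∃ (a : Fin d → ℝ) (b : ℝ), (∀ x ∈ P, dot a x ≤ b) ∧ F = {x | x ∈ P ∧ dot a x = b}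

/-- `z` is the lattice point of `F` pulled first by the ordering `ord`. -/
def IsPulledVertex {d : ℕ} (ord : (Fin d → ℤ) → ℕ) (F : Set (Fin d → ℝ))
    (z : Fin d → ℤ) : Prop :=
  intCast z ∈ F ∧ ∀ w : Fin d → ℤ, intCast w ∈ F → w ≠ z → ord z < ord w

/-- The full-dimensional cells of the pulling triangulation of `P` with respect
to an ordering `ord` of the points: they correspond to chains
`P = F 0 ⊋ F 1 ⊋ ⋯ ⊋ F d` of faces, `dim F i = d - i`, where `v i` is the point
of `F i` pulled first by `ord` and `F (i+1)` is a facet of `F i` avoiding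
`v i`; the cell is the simplex on the lattice points `v 0, …, v d`. -/
def IsPullingCell {d : ℕ} (P : Set (Fin d → ℝ)) (ord : (Fin d → ℤ) → ℕ)
    (F : Fin (d + 1) → Set (Fin d → ℝ)) (v : Fin (d + 1) → Fin d → ℤ) : Prop :=
  F 0 = P ∧
  (∀ i, IsFaceOf (F i) P) ∧
  (∀ i : Fin d, F i.succ ⊆ F i.castSucc) ∧
  (∀ i : Fin (d + 1), Module.finrank ℝ (vectorSpan ℝ (F i)) = d - (i : ℕ)) ∧
  (∀ i, IsPulledVertex ord (F i) (v i)) ∧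
  (∀ i : Fin d, intCast (v i.castSucc) ∉ F i.succ)

/-- A lattice `d`-simplex on the points `v 0, …, v d` is unimodular if the edge
vectors at `v 0` form a lattice basis, i.e. have determinant `±1`. -/
def IsUnimodularSimplex {d : ℕ} (v : Fin (d + 1) → Fin d → ℤ) : Prop :=
  (Matrix.det (Matrix.of fun i j : Fin d => v i.succ j - v 0 j)).natAbs = 1

/-- `P` is compressed: every cell of every pulling triangulation (with respect
to any ordering of the points) is unimodular. -/
def IsCompressed {d : ℕ} (P : Set (Fin d → ℝ)) : Prop :=
  ∀ ord : (Fin d → ℤ) → ℕ, Function.Injective ord →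
    ∀ (F : Fin (d + 1) → Set (Fin d → ℝ)) (v : Fin (d + 1) → Fin d → ℤ),
      IsPullingCell P ord F v → IsUnimodularSimplex v

section ConvexHull

variable {E : Type*} [AddCommGroup E] [Module ℝ E]

lemma le_of_mem_convexHull {s : Set E} {f : Module.Dual ℝ E} {β : ℝ}
    (h : ∀ v ∈ s, f v ≤ β) {x : E} (hx : x ∈ convexHull ℝ s) : f x ≤ β :=
  convexHull_min (t := {x | f x ≤ β}) h (convex_halfSpace_le f.isLinear β) hx

/-- A bound for `c` on the vertices of the face `a = b` becomes valid on all vertices after adding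
a large multiple of `a - b`. -/
lemma exists_mul_add_le (V : Finset E) (a c : Module.Dual ℝ E) {b β : ℝ}
    (ha : ∀ v ∈ V, a v ≤ b) (hc : ∀ v ∈ V, a v = b → c v ≤ β) :
    ∃ N : ℝ, ∀ M ≥ N, ∀ v ∈ V, M * a v + c v ≤ M * b + β := by
  have : ∀ᶠ N : ℝ in Filter.atTop, ∀ v ∈ V, ∀ M ≥ N, M * a v + c v ≤ M * b + β := by
    rw [Finset.eventually_all]
    intro v hv
    rcases (ha v hv).eq_or_lt with h | h
    · exact Filter.Eventually.of_forall fun N M _ => by rw [h]; linarith [hc v hv h]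
    · filter_upwards [Filter.eventually_ge_atTop ((c v - β) / (b - a v))] with N hN M hM
      have := (div_le_iff₀ (sub_pos.2 h)).1 (hN.trans hM)
      linarith
  obtain ⟨N, hN⟩ := this.exists
  exact ⟨N, fun M hM v hv => hN v hv M hM⟩

lemma le_of_mem_face {V : Finset E} {a c : Module.Dual ℝ E} {b β : ℝ}
    (ha : ∀ v ∈ V, a v ≤ b) (hc : ∀ v ∈ V, a v = b → c v ≤ β) {x : E}
    (hx : x ∈ convexHull ℝ (V : Set E)) (hxb : a x = b) : c x ≤ β := by
  obtain ⟨N, hN⟩ := exists_mul_add_le V a c ha hc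
  have := le_of_mem_convexHull (f := N • a + c) (β := N * b + β)
    (fun v hv => by simpa using hN N le_rfl v hv) hx
  simp only [LinearMap.add_apply, LinearMap.smul_apply, smul_eq_mul, hxb] at this
  linarith

lemma eq_of_mem_face {V : Finset E} {a c : Module.Dual ℝ E} {b β : ℝ}
    (ha : ∀ v ∈ V, a v ≤ b) (hc : ∀ v ∈ V, a v = b → c v = β) {x : E}
    (hx : x ∈ convexHull ℝ (V : Set E)) (hxb : a x = b) : c x = β := by
  refine le_antisymm (le_of_mem_face ha (fun v hv h => (hc v hv h).le) hx hxb) ?_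
  have := le_of_mem_face (c := -c) (β := -β) ha
    (fun v hv h => by simp [hc v hv h]) hx hxb
  simpa using this

lemma exists_vertex_mem_face {V : Finset E} {a : Module.Dual ℝ E} {b : ℝ}
    (ha : ∀ v ∈ V, a v ≤ b) {x : E}
    (hx : x ∈ convexHull ℝ (V : Set E)) (hxb : a x = b) : ∃ v ∈ V, a v = b := by
  by_contra! h
  have := le_of_mem_face (c := 0) (β := -1) ha (fun v hv hv' => (h v hv hv').elim) hx hxb
  norm_num at this

/-- A functional maximal at `w` on `V`, but not at `z`, can be tilted to one with more tight
points, which together with `z` determine all affine functions on `V`. -/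
lemma exists_facet_functional (V : Finset E) (w z : E) (c : Module.Dual ℝ E)
    (hc : ∀ v ∈ V, c v ≤ c w) (hz : c z < c w) :
    ∃ f : Module.Dual ℝ E, (∀ v ∈ V, f v ≤ f w) ∧ f z < f w ∧
      (∀ v ∈ V, c v = c w → f v = f w) ∧
      ∀ g : Module.Dual ℝ E, (∀ v ∈ V, f v = f w → g v = g w) → g z = g w →
        ∀ v ∈ V, g v = g w := by
  induction hn : (V.filter fun v => c v < c w).card using Nat.strong_induction_on
    generalizing c with
  | _ n ih =>
  subst hn
  by_cases H : ∀ g : Module.Dual ℝ E, (∀ v ∈ V, c v = c w → g v = g w) → g z = g w →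
      ∀ v ∈ V, g v = g w
  · exact ⟨c, hc, hz, fun _ _ => id, H⟩
  obtain ⟨g, hgt, hgz, v₀, hv₀, hgv₀⟩ : ∃ g : Module.Dual ℝ E,
      (∀ v ∈ V, c v = c w → g v = g w) ∧ g z = g w ∧ ∃ v ∈ V, g w < g v := by
    push Not at H
    obtain ⟨g, h1, h2, v, hv, hne⟩ := H
    rcases hne.lt_or_gt with h | h
    · exact ⟨-g, fun v hv h => by simp [h1 v hv h], by simp [h2], v, hv, by simpa using h⟩
    · exact ⟨g, h1, h2, v, hv, h⟩
  obtain ⟨v₁, hv₁, hmin⟩ := (V.filter fun v => g w < g v).exists_min_image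
    (fun v => (c w - c v) / (g v - g w)) ⟨v₀, by simp [hv₀, hgv₀]⟩
  obtain ⟨hv₁V, hgv₁⟩ := Finset.mem_filter.1 hv₁
  set t := (c w - c v₁) / (g v₁ - g w) with ht
  have ht0 : 0 ≤ t := div_nonneg (sub_nonneg.2 (hc v₁ hv₁V)) (sub_pos.2 hgv₁).le
  have htight : c v₁ + t * g v₁ = c w + t * g w := by
    have := div_mul_cancel₀ (c w - c v₁) (sub_pos.2 hgv₁).ne'
    rw [← ht] at this
    linarith
  have hle : ∀ v ∈ V, (c + t • g) v ≤ (c + t • g) w := by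
    intro v hv
    simp only [LinearMap.add_apply, LinearMap.smul_apply, smul_eq_mul]
    rcases le_or_gt (g v) (g w) with h | h
    · linarith [hc v hv, mul_le_mul_of_nonneg_left h ht0]
    · have := (le_div_iff₀ (sub_pos.2 h)).1 (hmin v (Finset.mem_filter.2 ⟨hv, h⟩))
      linarith
  have htight_of : ∀ v ∈ V, c v = c w → (c + t • g) v = (c + t • g) w :=
    fun v hv h => by simp [h, hgt v hv h]
  suffices hcard : (V.filter fun v => (c + t • g) v < (c + t • g) w).card <
      (V.filter fun v => c v < c w).card by
    obtain ⟨f, h1, h2, h3, h4⟩ := ih _ hcard (c + t • g) hle (by simp [hgz, hz]) rfl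
    exact ⟨f, h1, h2, fun v hv h => h3 v hv (htight_of v hv h), h4⟩
  refine Finset.card_lt_card ?_
  refine Finset.ssubset_iff_of_subset (fun v hv => ?_) |>.2 ⟨v₁, ?_, ?_⟩
  · obtain ⟨hv, hlt⟩ := Finset.mem_filter.1 hv
    refine Finset.mem_filter.2 ⟨hv, (hc v hv).lt_of_ne fun h => hlt.ne (htight_of v hv h)⟩
  · exact Finset.mem_filter.2 ⟨hv₁V, (hc v₁ hv₁V).lt_of_ne fun h => hgv₁.ne' (hgt v₁ hv₁V h)⟩
  · simp [htight]

lemma vectorSpan_le_ker_iff {s : Set E} {g : Module.Dual ℝ E} :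
    vectorSpan ℝ s ≤ g.ker ↔ ∀ x ∈ s, ∀ y ∈ s, g x = g y := by
  constructor
  · intro h x hx y hy
    have := h (vsub_mem_vectorSpan ℝ hx hy)
    simpa [sub_eq_zero] using this
  · intro h
    rw [vectorSpan_def, Submodule.span_le]
    rintro _ ⟨x, hx, y, hy, rfl⟩
    simp [h x hx y hy]

lemma finrank_eq_add_one [FiniteDimensional ℝ E] {S L : Submodule ℝ E} {f : Module.Dual ℝ E}
    {y : E} (hSL : S ≤ L) (hy : y ∈ L) (hSf : S ≤ f.ker) (hfy : f y ≠ 0)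
    (h : ∀ g : Module.Dual ℝ E, S ≤ g.ker → g y = 0 → L ≤ g.ker) :
    Module.finrank ℝ L = Module.finrank ℝ S + 1 := by
  have hL : S ⊔ Submodule.span ℝ {y} = L := by
    refine le_antisymm (sup_le hSL (by simpa using hy)) fun x hx => ?_
    by_contra hxS
    obtain ⟨g, hgx, hg⟩ := Submodule.exists_le_ker_of_notMem hxS
    exact hgx (h g (le_sup_left.trans hg)
      (hg (Submodule.mem_sup_right (Submodule.mem_span_singleton_self y))) hx)
  have hy0 : y ≠ 0 := by rintro rfl; simp at hfy
  have hinf : S ⊓ Submodule.span ℝ {y} = ⊥ := by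
    rw [eq_bot_iff]
    rintro x ⟨hxS, hxy⟩
    obtain ⟨r, rfl⟩ := Submodule.mem_span_singleton.1 hxy
    have : r * f y = 0 := by simpa using hSf hxS
    simp [(mul_eq_zero.1 this).resolve_right hfy]
  have := Submodule.finrank_sup_add_finrank_inf_eq S (Submodule.span ℝ {y})
  rwa [hL, hinf, finrank_bot, finrank_span_singleton hy0, add_zero] at this

/-- Every face of positive dimension of a polytope has a facet avoiding a given point. -/
lemma exists_facet_notMem [FiniteDimensional ℝ E] {V : Finset E} {a : Module.Dual ℝ E} {b : ℝ}
    (ha : ∀ v ∈ V, a v ≤ b) {z : E} (hz : z ∈ convexHull ℝ (V : Set E)) (hzb : a z = b)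
    (hdim : 0 < Module.finrank ℝ
      (vectorSpan ℝ {x | x ∈ convexHull ℝ (V : Set E) ∧ a x = b})) :
    ∃ (a' : Module.Dual ℝ E) (b' : ℝ), (∀ v ∈ V, a' v ≤ b') ∧ (∃ v ∈ V, a' v = b') ∧
      {x | x ∈ convexHull ℝ (V : Set E) ∧ a' x = b'} ⊆
        {x | x ∈ convexHull ℝ (V : Set E) ∧ a x = b} ∧ a' z ≠ b' ∧
      Module.finrank ℝ (vectorSpan ℝ {x | x ∈ convexHull ℝ (V : Set E) ∧ a x = b}) =
        Module.finrank ℝ (vectorSpan ℝ {x | x ∈ convexHull ℝ (V : Set E) ∧ a' x = b'}) + 1 := by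
  obtain ⟨c, v₀, hv₀, hv₀b, hcv₀⟩ : ∃ c : Module.Dual ℝ E, ∃ v ∈ V, a v = b ∧ c z < c v := by
    by_contra! H
    have hconst : ∀ c : Module.Dual ℝ E, ∀ v ∈ V, a v = b → c v = c z := fun c v hv hvb =>
      le_antisymm (H c v hv hvb) (by simpa using H (-c) v hv hvb)
    refine hdim.ne' (Submodule.finrank_eq_zero.2 (eq_bot_iff.2 fun x hx => ?_))
    refine (Module.forall_dual_apply_eq_zero_iff ℝ x).1 fun c => ?_
    refine (vectorSpan_le_ker_iff (g := c)).2 ?_ hx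
    rintro x ⟨hx, hxb⟩ y ⟨hy, hyb⟩
    rw [eq_of_mem_face ha (hconst c) hx hxb, eq_of_mem_face ha (hconst c) hy hyb]
  obtain ⟨w, hw, hmax⟩ := (V.filter fun v => a v = b).exists_max_image c
    ⟨v₀, Finset.mem_filter.2 ⟨hv₀, hv₀b⟩⟩
  obtain ⟨hwV, hwb⟩ := Finset.mem_filter.1 hw
  obtain ⟨f, hf, hfz, -, hfspan⟩ := exists_facet_functional (V.filter fun v => a v = b) w z c hmax
    (hcv₀.trans_le (hmax v₀ (Finset.mem_filter.2 ⟨hv₀, hv₀b⟩)))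
  simp only [Finset.mem_filter, and_imp] at hf hfspan
  obtain ⟨N, hN⟩ := exists_mul_add_le V a f ha hf
  have key : {x | x ∈ convexHull ℝ (V : Set E) ∧ ((N + 1) • a + f) x = (N + 1) * b + f w} =
      {x | x ∈ convexHull ℝ (V : Set E) ∧ a x = b ∧ f x = f w} := by
    ext x
    simp only [Set.mem_ofPred_eq, LinearMap.add_apply, LinearMap.smul_apply, smul_eq_mul]
    refine and_congr_right fun hx => ⟨fun h => ?_, fun ⟨h1, h2⟩ => by rw [h1, h2]⟩
    have h1 : a x ≤ b := le_of_mem_convexHull ha hx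
    have h2 := le_of_mem_convexHull (f := N • a + f) (β := N * b + f w)
      (fun v hv => by simpa using hN N le_rfl v hv) hx
    simp only [LinearMap.add_apply, LinearMap.smul_apply, smul_eq_mul] at h2
    have h3 : a x = b := by linarith
    exact ⟨h3, by rw [h3] at h; linarith⟩
  refine ⟨(N + 1) • a + f, (N + 1) * b + f w, fun v hv => ?_, ⟨w, hwV, by simp [hwb]⟩, ?_, ?_, ?_⟩
  · simpa using hN (N + 1) (by linarith) v hv
  · rw [key]
    exact fun x hx => ⟨hx.1, hx.2.1⟩
  · simpa [hzb] using hfz.ne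
  · rw [key]
    have hwP := subset_convexHull ℝ (V : Set E) hwV
    refine finrank_eq_add_one (f := f) (y := z - w)
      (vectorSpan_mono ℝ fun x hx => ⟨hx.1, hx.2.1⟩)
      (vsub_mem_vectorSpan ℝ ⟨hz, hzb⟩ ⟨hwP, hwb⟩)
      (vectorSpan_le_ker_iff.2 fun x hx y hy => hx.2.2.trans hy.2.2.symm)
      (by simpa [sub_eq_zero] using hfz.ne) fun g hg hgy => ?_
    have hgw := hfspan g
      (fun v hv hvb hfv => vectorSpan_le_ker_iff.1 hg v
        ⟨subset_convexHull ℝ (V : Set E) hv, hvb, hfv⟩ w ⟨hwP, hwb, rfl⟩)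
      (by simpa [sub_eq_zero] using hgy)
    refine vectorSpan_le_ker_iff.2 fun x hx y hy => ?_
    rw [eq_of_mem_face ha hgw hx.1 hx.2, eq_of_mem_face ha hgw hy.1 hy.2]

end ConvexHull

section Lattice

variable {d : ℕ}

/-- `dot a` as a linear functional. -/
def dotLin (a : Fin d → ℝ) : Module.Dual ℝ (Fin d → ℝ) := dotProductEquiv ℝ (Fin d) a

@[simp]
lemma dotLin_apply (a x : Fin d → ℝ) : dotLin a x = dot a x := rfl

lemma exists_eq_dotLin (f : Module.Dual ℝ (Fin d → ℝ)) : ∃ p, f = dotLin p :=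
  ⟨(dotProductEquiv ℝ (Fin d)).symm f, ((dotProductEquiv ℝ (Fin d)).apply_symm_apply f).symm⟩

lemma dotLin_injective : Function.Injective (dotLin (d := d)) :=
  (dotProductEquiv ℝ (Fin d)).injective

@[simp]
lemma dot_intCast (a z : Fin d → ℤ) : dot (intCast a) (intCast z) = ((a ⬝ᵥ z : ℤ) : ℝ) := by
  simp [dot, intCast, dotProduct]

lemma dotLin_intCast_ne_zero {a : Fin d → ℤ} (h : a ≠ 0) : dotLin (intCast a) ≠ 0 := by
  intro h0
  refine h (funext fun i => ?_)
  have : intCast a = 0 := dotLin_injective (h0.trans (by simp [dotLin]))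
  simpa [intCast] using congrFun this i

lemma ne_zero_of_gcd_eq_one {a : Fin d → ℤ} (h : Finset.univ.gcd a = 1) : a ≠ 0 := by
  rintro rfl
  have : Finset.univ.gcd (0 : Fin d → ℤ) = 0 := Finset.gcd_eq_zero_iff.2 (by simp)
  simp [this] at h

/-- A real hyperplane spanned by lattice vectors has an integral normal vector. -/
lemma exists_integral_normal {f : Module.Dual ℝ (Fin d → ℝ)} (hf : f ≠ 0) {T : Set (Fin d → ℤ)}
    (hT : ∀ u ∈ T, f (intCast u) = 0)
    (hann : ∀ g : Module.Dual ℝ (Fin d → ℝ), (∀ u ∈ T, g (intCast u) = 0) → ∃ r : ℝ, g = r • f) :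
    ∃ (m : Fin d → ℤ) (r : ℝ), r ≠ 0 ∧ dotLin (intCast m) = r • f := by
  obtain ⟨p, rfl⟩ := exists_eq_dotLin f
  obtain ⟨j, hj⟩ : ∃ j, p j ≠ 0 := by
    by_contra! h
    exact hf (by rw [show p = 0 from funext h]; simp [dotLin])
  obtain ⟨φ, hφ⟩ : ∃ φ : Module.Dual ℚ ℝ, φ (p j) ≠ 0 := by
    by_contra! h
    exact hj ((Module.forall_dual_apply_eq_zero_iff ℚ (p j)).1 h)
  obtain ⟨D, hD⟩ := IsLocalization.exist_integer_multiples_of_finite (nonZeroDivisors ℤ)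
    (fun i => φ (p i))
  choose m hm using hD
  have hm' : ∀ i, (m i : ℚ) = (D : ℤ) * φ (p i) := fun i => by
    simpa [Algebra.smul_def] using hm i
  have hmT : ∀ u ∈ T, dotLin (intCast m) (intCast u) = 0 := by
    intro u hu
    have h1 : φ (∑ i, (u i : ℚ) • p i) = 0 := by
      have : ∑ i, (u i : ℚ) • p i = dotLin p (intCast u) := by
        simp [dot, intCast, Rat.smul_def, mul_comm]
      rw [this, hT u hu, map_zero]
    have h2 : ((m ⬝ᵥ u : ℤ) : ℚ) = 0 := by
      rw [← mul_zero ((D : ℤ) : ℚ), ← h1, map_sum, Finset.mul_sum]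
      simp only [dotProduct, Int.cast_sum, Int.cast_mul, hm', map_smul, smul_eq_mul]
      exact Finset.sum_congr rfl fun i _ => by ring
    rw [dotLin_apply, dot_intCast, Int.cast_eq_zero.1 h2, Int.cast_zero]
  obtain ⟨r, hr⟩ := hann _ hmT
  refine ⟨m, r, ?_, hr⟩
  rintro rfl
  have hm0 : m = 0 := by
    by_contra h
    exact dotLin_intCast_ne_zero h (by simpa using hr)
  have := hm' j
  simp [hm0, hφ] at this

lemma exists_primitive_normal {f : Module.Dual ℝ (Fin d → ℝ)} (hf : f ≠ 0) {T : Set (Fin d → ℤ)}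
    (hT : ∀ u ∈ T, f (intCast u) = 0)
    (hann : ∀ g : Module.Dual ℝ (Fin d → ℝ), (∀ u ∈ T, g (intCast u) = 0) → ∃ r : ℝ, g = r • f) :
    ∃ (a : Fin d → ℤ) (r : ℝ), 0 < r ∧ Finset.univ.gcd a = 1 ∧ dotLin (intCast a) = r • f := by
  obtain ⟨m, r, hr, hm⟩ : ∃ (m : Fin d → ℤ) (r : ℝ), 0 < r ∧ dotLin (intCast m) = r • f := by
    obtain ⟨m, r, hr, hm⟩ := exists_integral_normal hf hT hann
    rcases hr.lt_or_gt with h | h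
    · refine ⟨-m, -r, neg_pos.2 h, ?_⟩
      have : intCast (-m) = -intCast m := by ext; simp [intCast]
      rw [this, dotLin, map_neg, ← dotLin, hm]
      ext
      simp
    · exact ⟨m, r, h, hm⟩
  have hm0 : m ≠ 0 := by
    rintro rfl
    have h0 : dotLin (intCast (0 : Fin d → ℤ)) = 0 := by
      rw [show intCast (0 : Fin d → ℤ) = 0 by ext; simp [intCast]]
      simp [dotLin]
    exact smul_ne_zero hr.ne' hf (hm.symm.trans h0)
  obtain ⟨i, hi⟩ := Function.ne_iff.1 hm0
  obtain ⟨a, ha, hgcd⟩ := Finset.extract_gcd (s := Finset.univ) m ⟨i, Finset.mem_univ i⟩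
  set G := Finset.univ.gcd m
  have hG0 : 0 < G := lt_of_le_of_ne (Int.nonneg_of_normalize_eq_self Finset.normalize_gcd)
    fun h => hi (by simp [ha i (Finset.mem_univ i), ← h])
  have hGR : (0 : ℝ) < G := by exact_mod_cast hG0
  refine ⟨a, r / G, div_pos hr hGR, hgcd, ?_⟩
  have : intCast m = (G : ℝ) • intCast a := by
    ext i
    simp [intCast, ha i (Finset.mem_univ i)]
  rw [div_eq_inv_mul, mul_smul, ← hm, this, dotLin, dotLin, map_smul, smul_smul,
    inv_mul_cancel₀ hGR.ne', one_smul]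

/-- A face of a full-dimensional lattice polytope is contained in a facet avoiding a given point
outside of the face. -/
lemma exists_facetIneq {P : Set (Fin d → ℝ)} {V : Finset (Fin d → ℤ)}
    (hP : P = convexHull ℝ (intCast '' (V : Set (Fin d → ℤ)))) (hspan : vectorSpan ℝ P = ⊤)
    {c : Fin d → ℝ} {β : ℝ} (hc : ∀ x ∈ P, dot c x ≤ β) {w z : Fin d → ℤ} (hw : intCast w ∈ P)
    (hwβ : dot c (intCast w) = β) (hz : intCast z ∈ P) (hzβ : dot c (intCast z) ≠ β) :
    ∃ (a : Fin d → ℤ) (b : ℤ), Finset.univ.gcd a = 1 ∧ IsFacetIneq P a b ∧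
      (∀ x ∈ P, dot c x = β → dot (intCast a) x = b) ∧ a ⬝ᵥ z < b := by
  classical
  have hP' : P = convexHull ℝ ((V.image intCast : Finset (Fin d → ℝ)) : Set (Fin d → ℝ)) := by
    rw [hP, Finset.coe_image]
  have hVP : ∀ v ∈ V.image intCast, v ∈ P := fun v hv => by
    rw [hP']
    exact subset_convexHull ℝ _ hv
  subst hwβ
  obtain ⟨f, hf, hfz, hfc, hfspan⟩ := exists_facet_functional (V.image intCast) (intCast w)
    (intCast z) (dotLin c) (fun v hv => hc v (hVP v hv)) ((hc _ hz).lt_of_ne hzβ)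
  have hzero : ∀ g : Module.Dual ℝ (Fin d → ℝ),
      (∀ v ∈ V.image intCast, f v = f (intCast w) → g v = g (intCast w)) →
      g (intCast z) = g (intCast w) → g = 0 := by
    intro g h1 h2
    have hg : vectorSpan ℝ P ≤ g.ker := by
      have hconst : ∀ x ∈ P, g x = g (intCast w) := fun x hx =>
        eq_of_mem_face (a := 0) (b := 0) (by simp) (fun v hv _ => hfspan g h1 h2 v hv)
          (hP' ▸ hx) rfl
      exact vectorSpan_le_ker_iff.2 fun x hx y hy => (hconst x hx).trans (hconst y hy).symm
    rwa [hspan, top_le_iff, LinearMap.ker_eq_top] at hg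
  have hann : ∀ g : Module.Dual ℝ (Fin d → ℝ),
      (∀ v ∈ V.image intCast, f v = f (intCast w) → g v = g (intCast w)) →
      ∃ r : ℝ, g = r • f := by
    intro g hg
    have hne : f (intCast z) - f (intCast w) ≠ 0 := (sub_neg.2 hfz).ne
    refine ⟨(g (intCast z) - g (intCast w)) / (f (intCast z) - f (intCast w)),
      sub_eq_zero.1 (hzero _ (fun v hv hfv => by simp [hg v hv hfv, hfv]) ?_)⟩
    have := div_mul_cancel₀ (g (intCast z) - g (intCast w)) hne
    simp only [LinearMap.sub_apply, LinearMap.smul_apply, smul_eq_mul]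
    linarith
  have hsub : ∀ u v : Fin d → ℤ, intCast (u - v) = intCast u - intCast v := fun u v => by
    ext; simp [intCast]
  have hf0 : f ≠ 0 := by rintro rfl; simp at hfz
  obtain ⟨a, r, hr, hgcd, har⟩ := exists_primitive_normal hf0
    (T := {u | ∃ v ∈ V, f (intCast v) = f (intCast w) ∧ u = v - w})
    (by rintro _ ⟨v, -, hv, rfl⟩; simp [hsub, hv])
    (fun g hg => hann g fun v hv hfv => by
      obtain ⟨u, hu, rfl⟩ := Finset.mem_image.1 hv
      simpa [hsub, sub_eq_zero] using hg _ ⟨u, hu, hfv, rfl⟩)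
  have hdot : ∀ x, dot (intCast a) x = r * f x := fun x => by
    rw [← dotLin_apply, har]; rfl
  have hb : ((a ⬝ᵥ w : ℤ) : ℝ) = r * f (intCast w) := by rw [← dot_intCast, hdot]
  have hfP : ∀ x ∈ P, f x ≤ f (intCast w) := fun x hx =>
    le_of_mem_convexHull hf (hP' ▸ hx)
  refine ⟨a, a ⬝ᵥ w, hgcd, ⟨fun x hx => ?_, ?_⟩, fun x hx hcx => ?_, ?_⟩
  · rw [hdot, hb]
    exact mul_le_mul_of_nonneg_left (hfP x hx) hr.le
  · have htight : {x | x ∈ P ∧ dot (intCast a) x = (a ⬝ᵥ w : ℤ)} =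
        {x | x ∈ P ∧ f x = f (intCast w)} := by
      ext x
      simp [hdot, hb, hr.ne']
    rw [htight]
    have := finrank_eq_add_one (S := vectorSpan ℝ {x | x ∈ P ∧ f x = f (intCast w)}) (L := ⊤)
      (f := f) (y := intCast z - intCast w) le_top trivial
      (vectorSpan_le_ker_iff.2 fun x hx y hy => hx.2.trans hy.2.symm)
      (by simpa [sub_eq_zero] using hfz.ne) fun g hg hgy => by
        rw [hzero g (fun v hv hfv => vectorSpan_le_ker_iff.1 hg v ⟨hVP v hv, hfv⟩ _ ⟨hw, rfl⟩)
          (by simpa [sub_eq_zero] using hgy), LinearMap.ker_zero]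
    rw [finrank_top, Module.finrank_fin_fun] at this
    omega
  · rw [hdot, hb, eq_of_mem_face (fun v hv => hc v (hVP v hv)) hfc (hP' ▸ hx) hcx]
  · have : ((a ⬝ᵥ z : ℤ) : ℝ) < ((a ⬝ᵥ w : ℤ) : ℝ) := by
      rw [hb, ← dot_intCast, hdot]
      exact mul_lt_mul_of_pos_left hfz hr
    exact_mod_cast this

end Lattice

section Unimodular

variable {d : ℕ}

lemma det_vertex_sub_eq_det_succ_sub (v : Fin (d + 1) → Fin d → ℤ) :
    (Matrix.of fun i j : Fin d => v i.succ j - v 0 j).det =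
      (Matrix.of fun i j : Fin d => v i.succ j - v i.castSucc j).det := by
  cases d with
  | zero => simp
  | succ n =>
    refine Matrix.det_eq_of_forall_row_eq_smul_add_pred (fun _ => 1) (fun j => by simp)
      fun i j => ?_
    simp only [Matrix.of_apply, one_mul, Fin.succ_castSucc]
    ring

lemma isUnimodularSimplex_of_normals {v : Fin (d + 1) → Fin d → ℤ} (a : Fin d → Fin d → ℤ)
    (b : Fin d → ℤ) (hlt : ∀ (i : Fin d) (j : Fin (d + 1)), i.castSucc < j → a i ⬝ᵥ v j = b i)
    (heq : ∀ i : Fin d, a i ⬝ᵥ v i.castSucc = b i - 1) : IsUnimodularSimplex v := by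
  rw [IsUnimodularSimplex, det_vertex_sub_eq_det_succ_sub, ← Int.isUnit_iff_natAbs_eq]
  set U : Matrix (Fin d) (Fin d) ℤ := Matrix.of fun i j => v i.succ j - v i.castSucc j
  have hentry : ∀ i j, (Matrix.of a * U.transpose) i j =
      a i ⬝ᵥ v j.succ - a i ⬝ᵥ v j.castSucc := fun i j => by
    rw [← dotProduct_sub]; rfl
  have htri : (Matrix.of a * U.transpose).IsLowerTriangular := fun i j hij => by
    have hij : i < j := hij
    rw [hentry, hlt i _ (Fin.castSucc_lt_castSucc_iff.2 hij |>.trans Fin.castSucc_lt_succ),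
      hlt i _ (Fin.castSucc_lt_castSucc_iff.2 hij), sub_self]
  have hdet : (Matrix.of a * U.transpose).det = 1 := by
    rw [Matrix.det_of_isLowerTriangular _ htri]
    refine Finset.prod_eq_one fun i _ => ?_
    rw [hentry, hlt i _ Fin.castSucc_lt_succ, heq]
    ring
  rw [Matrix.det_mul, Matrix.det_transpose, mul_comm] at hdet
  exact IsUnit.of_mul_eq_one _ hdet

/-- The vertices of a unimodular simplex off a primitive hyperplane containing the opposite facet
have lattice distance one from it. -/
lemma IsUnimodularSimplex.isUnit_sub {v : Fin (d + 1) → Fin d → ℤ} (hv : IsUnimodularSimplex v)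
    {a : Fin d → ℤ} (ha : Finset.univ.gcd a = 1) {b : ℤ} (hb : ∀ i : Fin d, a ⬝ᵥ v i.succ = b) :
    IsUnit (b - a ⬝ᵥ v 0) := by
  set N : Matrix (Fin d) (Fin d) ℤ := Matrix.of fun i j => v i.succ j - v 0 j
  have hdet : IsUnit N.det := Int.isUnit_iff_natAbs_eq.2 hv
  have hNa : N.mulVec a = (b - a ⬝ᵥ v 0) • fun _ => (1 : ℤ) := by
    ext i
    have : N.mulVec a i = (v i.succ - v 0) ⬝ᵥ a := rfl
    rw [this, sub_dotProduct, dotProduct_comm, hb, dotProduct_comm (v 0)]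
    simp
  have ha' : a = (b - a ⬝ᵥ v 0) • (N⁻¹).mulVec fun _ => (1 : ℤ) := by
    rw [← Matrix.mulVec_smul, ← hNa, Matrix.mulVec_mulVec, Matrix.nonsing_inv_mul _ hdet,
      Matrix.one_mulVec]
  rw [isUnit_iff_dvd_one, ← ha]
  refine Finset.dvd_gcd fun i _ => ?_
  have := congrFun ha' i
  rw [this]
  exact ⟨_, rfl⟩

end Unimodular

section Compressed

variable {d : ℕ} {P : Set (Fin d → ℝ)} {V : Finset (Fin d → ℤ)}

lemma exists_vertex_forall_le (hP : P = convexHull ℝ (intCast '' (V : Set (Fin d → ℤ))))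
    (hV : V.Nonempty) (a : Fin d → ℤ) :
    ∃ v ∈ V, ∀ x ∈ P, dot (intCast a) x ≤ (a ⬝ᵥ v : ℤ) := by
  obtain ⟨v, hv, hmax⟩ := V.exists_max_image (fun v => a ⬝ᵥ v) hV
  refine ⟨v, hv, fun x hx => ?_⟩
  rw [hP] at hx
  refine le_of_mem_convexHull (f := dotLin (intCast a)) ?_ hx
  rintro _ ⟨u, hu, rfl⟩
  simpa using hmax u hu

lemma exists_vertex_forall_ge (hP : P = convexHull ℝ (intCast '' (V : Set (Fin d → ℤ))))
    (hV : V.Nonempty) (a : Fin d → ℤ) :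
    ∃ v ∈ V, ∀ x ∈ P, (a ⬝ᵥ v : ℤ) ≤ dot (intCast a) x := by
  obtain ⟨v, hv, h⟩ := exists_vertex_forall_le hP hV (-a)
  refine ⟨v, hv, fun x hx => ?_⟩
  have := h x hx
  rw [neg_dotProduct, Int.cast_neg] at this
  have hneg : dot (intCast (-a)) x = -dot (intCast a) x := by simp [dot, intCast]
  linarith

lemma vectorSpan_eq_top_of_interior_nonempty (h : (interior P).Nonempty) :
    vectorSpan ℝ P = ⊤ := by
  have := AffineSubspace.vectorSpan_eq_top_of_affineSpan_eq_top ℝ _ _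
    (isOpen_interior.affineSpan_eq_top h)
  exact top_le_iff.1 (this ▸ vectorSpan_mono ℝ interior_subset)

lemma isCompressed_of_hasFacetWidthOne
    (hP : P = convexHull ℝ (intCast '' (V : Set (Fin d → ℤ)))) (hV : V.Nonempty)
    (hspan : vectorSpan ℝ P = ⊤) (h : HasFacetWidthOne P) : IsCompressed P := by
  rintro ord - F v ⟨hF0, hface, hsub, -, hpull, hnot⟩
  have hanti : Antitone F := Fin.antitone_iff_succ_le.2 hsub
  have hFP : ∀ i, F i ⊆ P := fun i => hF0 ▸ hanti (Fin.zero_le i)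
  have hex : ∀ i : Fin d, ∃ (a : Fin d → ℤ) (b : ℤ),
      (∀ j, i.castSucc < j → a ⬝ᵥ v j = b) ∧ a ⬝ᵥ v i.castSucc = b - 1 := by
    intro i
    obtain ⟨c, β, hc, hFc⟩ := hface i.succ
    have hw := (hpull i.succ).1
    have hz := hFP _ (hpull i.castSucc).1
    have hwP := hFP _ hw
    obtain ⟨a, b, hgcd, hfacet, htight, hlt⟩ := exists_facetIneq hP hspan hc (z := v i.castSucc)
      (w := v i.succ) hwP (by rw [hFc] at hw; exact hw.2) hz
      fun h => hnot i (by rw [hFc]; exact ⟨hz, h⟩)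
    have hval : ∀ j, i.castSucc < j → a ⬝ᵥ v j = b := by
      intro j hj
      have hmem := hanti (Fin.castSucc_lt_iff_succ_le.1 hj) (hpull j).1
      rw [hFc] at hmem
      have := htight _ hmem.1 hmem.2
      rw [dot_intCast] at this
      exact_mod_cast this
    refine ⟨a, b, hval, ?_⟩
    have hwidth := h a b hgcd hfacet
    have hmax : IsGreatest ((fun x => dot (intCast a) x) '' P) b := by
      refine ⟨⟨_, hwP, ?_⟩, ?_⟩
      · simp [hval _ Fin.castSucc_lt_succ]
      · rintro _ ⟨x, hx, rfl⟩
        exact hfacet.1 x hx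
    obtain ⟨u, hu, hmin⟩ := exists_vertex_forall_ge hP hV a
    have hbdd : BddBelow ((fun x => dot (intCast a) x) '' P) :=
      ⟨_, by rintro _ ⟨x, hx, rfl⟩; exact hmin x hx⟩
    have hle := csInf_le hbdd ⟨_, hz, rfl⟩
    rw [hmax.csSup_eq] at hwidth
    simp only [dot_intCast] at hle
    have : (b : ℝ) - 1 ≤ ((a ⬝ᵥ v i.castSucc : ℤ) : ℝ) := by linarith
    have : b - 1 ≤ a ⬝ᵥ v i.castSucc := by exact_mod_cast this
    omega
  choose a b hval heq using hex
  exact isUnimodularSimplex_of_normals a b hval heq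

lemma exists_isPulledVertex {ord : (Fin d → ℤ) → ℕ} (hord : Function.Injective ord)
    {F : Set (Fin d → ℝ)} (hF : ∃ z : Fin d → ℤ, intCast z ∈ F) :
    ∃ z, IsPulledVertex ord F z := by
  obtain ⟨z, hz, hmin⟩ := (measure ord).wf.has_min {z | intCast z ∈ F} hF
  exact ⟨z, hz, fun w hw hne => (not_lt.1 (hmin w hw)).lt_of_ne fun h => hne (hord h.symm)⟩

lemma exists_subface (hP : P = convexHull ℝ (intCast '' (V : Set (Fin d → ℤ))))
    {F : Set (Fin d → ℝ)} (hF : IsFaceOf F P) {z : Fin d → ℝ} (hz : z ∈ F)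
    (hdim : 0 < Module.finrank ℝ (vectorSpan ℝ F)) :
    ∃ F', IsFaceOf F' P ∧ (∃ u : Fin d → ℤ, intCast u ∈ F') ∧ F' ⊆ F ∧ z ∉ F' ∧
      Module.finrank ℝ (vectorSpan ℝ F) = Module.finrank ℝ (vectorSpan ℝ F') + 1 := by
  classical
  rw [← Finset.coe_image] at hP
  obtain ⟨a, b, ha, rfl⟩ := hF
  subst hP
  have hV : ∀ v ∈ V.image intCast, v ∈ convexHull ℝ ((V.image intCast : Finset _) : Set _) :=
    fun v hv => subset_convexHull ℝ _ hv
  obtain ⟨f, b', hf, ⟨v, hv, hvb⟩, hsub, hzb, hfin⟩ := exists_facet_notMem (a := dotLin a) (b := b)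
    (fun v hv => ha v (hV v hv)) hz.1 hz.2 hdim
  obtain ⟨a', rfl⟩ := exists_eq_dotLin f
  obtain ⟨u, hu, rfl⟩ := Finset.mem_image.1 hv
  exact ⟨_, ⟨a', b', fun x hx => le_of_mem_convexHull (f := dotLin a') hf hx, rfl⟩,
    ⟨u, hV _ hv, hvb⟩, hsub, fun h => hzb h.2, hfin⟩

/-- A full pulling cell exists through any facet avoiding the first pulled point. -/
lemma exists_isPullingCell (hP : P = convexHull ℝ (intCast '' (V : Set (Fin d → ℤ))))
    (hspan : vectorSpan ℝ P = ⊤) (hd : 0 < d) {ord : (Fin d → ℤ) → ℕ}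
    (hord : Function.Injective ord) {z : Fin d → ℤ} (hz : IsPulledVertex ord P z)
    {G : Set (Fin d → ℝ)} (hG : IsFaceOf G P) (hGz : ∃ u : Fin d → ℤ, intCast u ∈ G)
    (hzG : intCast z ∉ G) (hGdim : Module.finrank ℝ (vectorSpan ℝ G) = d - 1) :
    ∃ (F : Fin (d + 1) → Set (Fin d → ℝ)) (v : Fin (d + 1) → Fin d → ℤ),
      IsPullingCell P ord F v ∧ v 0 = z ∧ ∀ i : Fin d, intCast (v i.succ) ∈ G := by
  classical
  let IsGood (F : Set (Fin d → ℝ)) : Prop := IsFaceOf F P ∧ ∃ u : Fin d → ℤ, intCast u ∈ F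
  have hpv : ∀ F, ∃ u, (IsGood F → IsPulledVertex ord F u) ∧ (F = P → u = z) := by
    intro F
    by_cases hFP : F = P
    · exact ⟨z, fun _ => hFP ▸ hz, fun _ => rfl⟩
    by_cases hF : IsGood F
    · obtain ⟨u, hu⟩ := exists_isPulledVertex hord hF.2
      exact ⟨u, fun _ => hu, fun h => (hFP h).elim⟩
    · exact ⟨0, fun h => (hF h).elim, fun h => (hFP h).elim⟩
  choose pv hpv hpvP using hpv
  have hPdim : Module.finrank ℝ (vectorSpan ℝ P) = d := by
    rw [hspan, finrank_top, Module.finrank_fin_fun]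
  have hstep : ∀ F, ∃ F', IsGood F → 0 < Module.finrank ℝ (vectorSpan ℝ F) →
      IsGood F' ∧ F' ⊆ F ∧ intCast (pv F) ∉ F' ∧
      Module.finrank ℝ (vectorSpan ℝ F) = Module.finrank ℝ (vectorSpan ℝ F') + 1 ∧
      (F = P → F' = G) := by
    intro F
    by_cases hFP : F = P
    · subst hFP
      refine ⟨G, fun _ _ => ⟨⟨hG, hGz⟩, ?_, ?_, by omega, fun _ => rfl⟩⟩
      · obtain ⟨a, b, -, rfl⟩ := hG
        exact fun x hx => hx.1
      · rwa [hpvP F rfl]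
    by_cases hF : IsGood F ∧ 0 < Module.finrank ℝ (vectorSpan ℝ F)
    · obtain ⟨F', h1, h2, h3, h4, h5⟩ := exists_subface hP hF.1.1 (hpv F hF.1).1 hF.2
      exact ⟨F', fun _ _ => ⟨⟨h1, h2⟩, h3, h4, h5, fun h => (hFP h).elim⟩⟩
    · exact ⟨F, fun h1 h2 => (hF ⟨h1, h2⟩).elim⟩
  choose step hstep using hstep
  let S (n : ℕ) : Set (Fin d → ℝ) := step^[n] P
  have hS : ∀ n, S (n + 1) = step (S n) := fun n => Function.iterate_succ_apply' step n P
  have hPgood : IsGood P := ⟨⟨0, 0, by simp [dot], by simp [dot]⟩, z, hz.1⟩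
  have hgood : ∀ n ≤ d, IsGood (S n) ∧ Module.finrank ℝ (vectorSpan ℝ (S n)) = d - n := by
    intro n
    induction n with
    | zero => exact fun _ => ⟨hPgood, hPdim⟩
    | succ n ih =>
      intro hn
      obtain ⟨h1, h2⟩ := ih (by omega)
      obtain ⟨h3, -, -, h4, -⟩ := hstep (S n) h1 (by omega)
      rw [hS]
      exact ⟨h3, by omega⟩
  have hnext : ∀ n < d, S (n + 1) ⊆ S n ∧ intCast (pv (S n)) ∉ S (n + 1) := by
    intro n hn
    obtain ⟨h1, h2⟩ := hgood n hn.le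
    obtain ⟨-, h3, h4, -, -⟩ := hstep (S n) h1 (by omega)
    rw [hS]
    exact ⟨h3, h4⟩
  have hS1 : S 1 = G := (hstep P hPgood (by omega)).2.2.2.2 rfl
  have hSG : ∀ n < d, S (n + 1) ⊆ G := by
    intro n
    induction n with
    | zero => exact fun _ => hS1.subset
    | succ n ih => exact fun hn => (hnext (n + 1) hn).1.trans (ih (by omega))
  have hpull : ∀ i : Fin (d + 1), IsPulledVertex ord (S i) (pv (S i)) := fun i =>
    hpv _ (hgood i (by omega)).1
  refine ⟨fun i => S i, fun i => pv (S i), ⟨rfl, fun i => (hgood i (by omega)).1.1,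
    fun i => (hnext i i.2).1, fun i => (hgood i (by omega)).2, hpull,
    fun i => (hnext i i.2).2⟩, hpvP _ rfl, fun i => hSG i i.2 (hpull i.succ).1⟩

lemma exists_injective_forall_ne_lt (z : Fin d → ℤ) :
    ∃ ord : (Fin d → ℤ) → ℕ, Function.Injective ord ∧ ∀ u, u ≠ z → ord z < ord u := by
  classical
  refine ⟨fun u => if u = z then 0 else Encodable.encode u + 1, fun u u' h => ?_, fun u hu => ?_⟩
  · by_cases hu : u = z <;> by_cases hu' : u' = z <;> simp_all
  · simp [hu]

lemma hasFacetWidthOne_of_isCompressed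
    (hP : P = convexHull ℝ (intCast '' (V : Set (Fin d → ℤ)))) (hV : V.Nonempty)
    (hspan : vectorSpan ℝ P = ⊤) (h : IsCompressed P) : HasFacetWidthOne P := by
  intro a b hgcd hfacet
  have ha0 := ne_zero_of_gcd_eq_one hgcd
  have hd : 0 < d := by
    obtain ⟨i, -⟩ := Function.ne_iff.1 ha0
    exact i.pos
  have hVP : ∀ v ∈ V, intCast v ∈ P := fun v hv => by
    rw [hP]
    exact subset_convexHull ℝ _ ⟨v, hv, rfl⟩
  obtain ⟨w, hw, hmax⟩ := exists_vertex_forall_le hP hV a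
  obtain ⟨z, hz, hmin⟩ := exists_vertex_forall_ge hP hV a
  have hsup : IsGreatest ((fun x => dot (intCast a) x) '' P) (a ⬝ᵥ w : ℤ) :=
    ⟨⟨_, hVP w hw, dot_intCast a w⟩, by rintro _ ⟨x, hx, rfl⟩; exact hmax x hx⟩
  have hinf : IsLeast ((fun x => dot (intCast a) x) '' P) (a ⬝ᵥ z : ℤ) :=
    ⟨⟨_, hVP z hz, dot_intCast a z⟩, by rintro _ ⟨x, hx, rfl⟩; exact hmin x hx⟩
  rw [hsup.csSup_eq, hinf.csInf_eq]
  have hker : ∀ {s : Set (Fin d → ℝ)} {β : ℝ}, (∀ x ∈ s, dot (intCast a) x = β) →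
      vectorSpan ℝ s ≤ (dotLin (intCast a)).ker := fun hs =>
    vectorSpan_le_ker_iff.2 fun x hx y hy => (hs x hx).trans (hs y hy).symm
  have hlt : a ⬝ᵥ z < a ⬝ᵥ w := by
    have hle : a ⬝ᵥ z ≤ a ⬝ᵥ w := by
      have := hmax _ (hVP z hz)
      rw [dot_intCast] at this
      exact_mod_cast this
    refine hle.lt_of_ne fun heq => dotLin_intCast_ne_zero ha0 ?_
    have := hker (s := P) fun x hx => le_antisymm (hmax x hx) (heq ▸ hmin x hx)
    rwa [hspan, top_le_iff, LinearMap.ker_eq_top] at this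
  set G := {x | x ∈ P ∧ dot (intCast a) x = (a ⬝ᵥ w : ℤ)}
  have hGdim : Module.finrank ℝ (vectorSpan ℝ G) = d - 1 := by
    rcases (show ((a ⬝ᵥ w : ℤ) : ℝ) ≤ b by
      simpa using hfacet.1 _ (hVP w hw)).eq_or_lt with hb | hb
    · rw [← hfacet.2, ← hb]
    · have hempty : {x | x ∈ P ∧ dot (intCast a) x = b} = ∅ :=
        Set.eq_empty_of_forall_notMem fun x hx => (hmax x hx.1).not_gt (hx.2 ▸ hb)
      have hd1 := hfacet.2
      rw [hempty, vectorSpan_empty, finrank_bot] at hd1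
      have hlt : vectorSpan ℝ G < ⊤ := lt_of_le_of_lt (hker fun x hx => hx.2)
        (lt_top_iff_ne_top.2 fun htop =>
          dotLin_intCast_ne_zero ha0 (LinearMap.ker_eq_top.1 htop))
      have := Submodule.finrank_lt hlt.ne
      rw [Module.finrank_fin_fun] at this
      omega
  obtain ⟨ord, hord, hzord⟩ := exists_injective_forall_ne_lt z
  obtain ⟨F, v, hcell, hv0, hvG⟩ := exists_isPullingCell hP hspan hd hord
    ⟨hVP z hz, fun u _ hu => hzord u hu⟩ (G := G) ⟨intCast a, _, hmax, rfl⟩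
    ⟨w, hVP w hw, dot_intCast a w⟩
    (fun hzG => hlt.ne (by simpa using hzG.2)) hGdim
  have hunit := (h ord hord F v hcell).isUnit_sub hgcd (b := a ⬝ᵥ w) fun i => by
    simpa using (hvG i).2
  rw [hv0, Int.isUnit_iff] at hunit
  have : a ⬝ᵥ w - a ⬝ᵥ z = 1 := by omega
  exact_mod_cast this

end Compressed

/-- a full-dimensional lattice polytope is compressed iff it has
facet width one. -/
theorem stmt7 {d : ℕ} (P : Set (Fin d → ℝ)) (hlat : IsLatticePolytope P)
    (hfull : (interior P).Nonempty) :
    IsCompressed P ↔ HasFacetWidthOne P := by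
  obtain ⟨V, hV, hP⟩ := hlat
  have hspan := vectorSpan_eq_top_of_interior_nonempty hfull
  exact ⟨hasFacetWidthOne_of_isCompressed hP hV hspan,
    isCompressed_of_hasFacetWidthOne hP hV hspan⟩
end

section
/- Let G = ([d], E) be a perfect graph. Then its stable set polytope satisfies P_G = {x ∈ ℝ^d_{≥0} : Σ_{i∈C} x_i ≤ 1 for all cliques C of G}. -/
open Finset

/-- Indicator vector of a subset of `[d]`. -/
def indVec {d : ℕ} (s : Finset (Fin d)) : Fin d → ℝ := fun i => if i ∈ s then 1 else 0

/-- A stable (independent) set of a graph. -/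
def IsStableSet {d : ℕ} (G : SimpleGraph (Fin d)) (s : Finset (Fin d)) : Prop :=
  ∀ i ∈ s, ∀ j ∈ s, ¬ G.Adj i j

/-- The stable set polytope: convex hull of indicator vectors of stable sets. -/
def stableSetPolytope {d : ℕ} (G : SimpleGraph (Fin d)) : Set (Fin d → ℝ) :=
  convexHull ℝ {x | ∃ s : Finset (Fin d), IsStableSet G s ∧ x = indVec s}

/-- The clique number of a graph, as an extended natural number. -/
noncomputable def cliqueNumber {V : Type*} (G : SimpleGraph V) : ℕ∞ :=
  sSup {n : ℕ∞ | ∃ (m : ℕ) (t : Finset V), n = (m : ℕ∞) ∧ G.IsNClique m t}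

/-- A graph is perfect if every induced subgraph has clique number equal to its
chromatic number. -/
def IsPerfect {d : ℕ} (G : SimpleGraph (Fin d)) : Prop :=
  ∀ s : Set (Fin d), cliqueNumber (G.induce s) = (G.induce s).chromaticNumber

/-- The `ℕ`-valued indicator function of a finite set. -/
def natInd {d : ℕ} (s : Finset (Fin d)) : Fin d → ℕ := fun i => if i ∈ s then 1 else 0

/-- A clique meets a stable set in at most one vertex. -/
lemma sum_natInd_le_one {d : ℕ} {G : SimpleGraph (Fin d)} {S C : Finset (Fin d)}
    (hS : IsStableSet G S) (hC : G.IsClique (C : Set (Fin d))) :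
    ∑ i ∈ C, natInd S i ≤ 1 := by
  simp only [natInd, Finset.sum_boole, Nat.cast_id]
  rw [Finset.card_le_one]
  intro a ha b hb
  rw [Finset.mem_filter] at ha hb
  by_contra hab
  exact hS a ha.2 b hb.2 (hC ha.1 hb.1 hab)

/-- The weight of a clique in a sum of stable sets is at most the number of these sets. -/
lemma sum_multiset_natInd_le_card {d : ℕ} {G : SimpleGraph (Fin d)} {C : Finset (Fin d)}
    (hC : G.IsClique (C : Set (Fin d))) (M : Multiset (Finset (Fin d)))
    (hM : ∀ S ∈ M, IsStableSet G S) :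
    ∑ i ∈ C, (M.map natInd).sum i ≤ M.card := by
  induction M using Multiset.induction_on with
  | empty => simp
  | cons S M ih =>
    have h₁ := sum_natInd_le_one (hM S (Multiset.mem_cons_self S M)) hC
    have h₂ := ih fun T hT => hM T (Multiset.mem_cons_of_mem hT)
    simp only [Multiset.map_cons, Multiset.sum_cons, Pi.add_apply, Finset.sum_add_distrib,
      Multiset.card_cons]
    omega

/-- In a perfect graph, a vertex set all of whose cliques have at most `k` elements is
partitioned by `k` stable sets. -/
lemma exists_stable_partition {d : ℕ} {G : SimpleGraph (Fin d)} (hG : IsPerfect G)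
    (w : Fin d → ℕ) (hw : ∀ i, w i ≤ 1) (k : ℕ)
    (hk : ∀ C : Finset (Fin d), G.IsClique (C : Set (Fin d)) → ∑ i ∈ C, w i ≤ k) :
    ∃ M : Multiset (Finset (Fin d)), M.card = k ∧ (∀ S ∈ M, IsStableSet G S) ∧
      (M.map natInd).sum = w := by
  classical
  let s : Set (Fin d) := {i | w i = 1}
  have hω : cliqueNumber (G.induce s) ≤ k := by
    refine sSup_le ?_
    rintro _ ⟨m, t, rfl, ht⟩
    have hC : G.IsClique ((t.map (Function.Embedding.subtype (· ∈ s)) : Finset (Fin d)) :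
        Set (Fin d)) := by
      intro a ha b hb hab
      simp only [Finset.coe_map, Set.mem_image, Finset.mem_coe] at ha hb
      obtain ⟨a, ha, rfl⟩ := ha
      obtain ⟨b, hb, rfl⟩ := hb
      exact ht.isClique ha hb fun h => hab (by rw [h])
    have h := hk _ hC
    have h₁ : ∀ i : s, w (Function.Embedding.subtype (· ∈ s) i) = 1 := fun i => i.2
    rw [Finset.sum_map, Finset.sum_congr rfl fun i _ => h₁ i] at h
    simp only [Finset.sum_const, smul_eq_mul, mul_one, ht.card_eq] at h
    exact_mod_cast h
  rw [hG s, SimpleGraph.chromaticNumber_le_iff_colorable] at hω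
  obtain ⟨c⟩ := hω
  let T : Fin k → Finset (Fin d) := fun j => univ.filter fun i => ∃ h : i ∈ s, c ⟨i, h⟩ = j
  refine ⟨(univ : Finset (Fin k)).val.map T, by simp, ?_, ?_⟩
  · intro S hS
    obtain ⟨j, -, rfl⟩ := Multiset.mem_map.1 hS
    intro a ha b hb hab
    obtain ⟨ha, hca⟩ := (Finset.mem_filter.1 ha).2
    obtain ⟨hb, hcb⟩ := (Finset.mem_filter.1 hb).2
    have hadj : (G.induce s).Adj ⟨a, ha⟩ ⟨b, hb⟩ := hab
    exact c.valid hadj (hca.trans hcb.symm)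
  · rw [Multiset.map_map]
    change ∑ j, natInd (T j) = w
    ext i
    rw [Finset.sum_apply]
    simp only [natInd, T, Finset.mem_filter, Finset.mem_univ, true_and]
    by_cases hi : i ∈ s
    · simp only [hi, exists_true_left, Finset.sum_ite_eq, Finset.mem_univ, if_true]
      exact (hi : w i = 1).symm
    · have h₀ : w i ≠ 1 := hi
      have h₁ := hw i
      simp only [hi, IsEmpty.exists_iff, if_false, Finset.sum_const_zero]
      omega

/-- Weighted colouring of perfect graphs: integral vertex weights for which every clique has
weight at most `k` are a sum of `k` stable sets. -/
lemma exists_stable_decomposition {d : ℕ} {G : SimpleGraph (Fin d)} (hG : IsPerfect G)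
    (w : Fin d → ℕ) (k : ℕ)
    (hk : ∀ C : Finset (Fin d), G.IsClique (C : Set (Fin d)) → ∑ i ∈ C, w i ≤ k) :
    ∃ M : Multiset (Finset (Fin d)), M.card = k ∧ (∀ S ∈ M, IsStableSet G S) ∧
      (M.map natInd).sum = w := by
  classical
  induction hn : ∑ i, w i using Nat.strong_induction_on generalizing w k with
  | _ n ih =>
  by_cases hw : ∀ i, w i ≤ 1
  · exact exists_stable_partition hG w hw k hk
  push Not at hw
  obtain ⟨x, hx⟩ := hw
  obtain ⟨w', hw'⟩ : ∃ w' : Fin d → ℕ, w = w' + natInd {x} := by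
    refine ⟨fun i => w i - natInd {x} i, ?_⟩
    ext i
    by_cases h : i = x
    · subst h
      simp [natInd]
      omega
    · simp [natInd, h]
  have hwx : 1 ≤ w' x := by
    have := congrFun hw' x
    simp [natInd] at this
    omega
  have hsum : ∑ i, w i = ∑ i, w' i + 1 := by
    simp [hw', Finset.sum_add_distrib, natInd]
  obtain ⟨M, hMk, hM, hMw⟩ := ih (∑ i, w' i) (by omega) w' k
    (fun C hC => le_trans (Finset.sum_le_sum fun i _ => by simp [hw']) (hk C hC)) rfl
  obtain ⟨S, hSM, hxS⟩ : ∃ S ∈ M, x ∈ S := by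
    by_contra! h
    have h₀ : (M.map natInd).sum x = 0 := by
      rw [Pi.multiset_sum_apply, Multiset.sum_eq_zero_iff]
      intro a ha
      simp only [Multiset.map_map, Multiset.mem_map, Function.comp_apply] at ha
      obtain ⟨S, hS, rfl⟩ := ha
      simp [natInd, h S hS]
    rw [hMw] at h₀
    omega
  obtain ⟨M, rfl⟩ := Multiset.exists_cons_of_mem hSM
  have hM' : ∀ T ∈ M, IsStableSet G T := fun T hT => hM T (Multiset.mem_cons_of_mem hT)
  rw [Multiset.map_cons, Multiset.sum_cons] at hMw
  rw [Multiset.card_cons] at hMk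
  set v := (M.map natInd).sum with hv
  have hw_eq : w = natInd S + (v + natInd {x}) := by rw [hw', ← hMw, add_assoc]
  have hlt : ∑ i, (v + natInd {x}) i < n := by
    rw [← hn, hw_eq]
    refine Finset.sum_lt_sum (fun i _ => by simp) ⟨x, Finset.mem_univ x, ?_⟩
    simp [natInd, hxS]
  obtain ⟨N, hNk, hN, hNw⟩ := ih _ hlt (v + natInd {x}) M.card (by
    intro C hC
    by_cases hxC : x ∈ C
    · have h := hk C hC
      have h₁ : 1 ≤ ∑ i ∈ C, natInd S i := by
        refine le_trans ?_ (Finset.single_le_sum (fun i _ => Nat.zero_le _) hxC)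
        simp [natInd, hxS]
      rw [hw_eq] at h
      simp only [Pi.add_apply, Finset.sum_add_distrib] at h ⊢
      omega
    · have h₀ : ∑ i ∈ C, natInd {x} i = 0 := by simp [natInd, hxC]
      have h₁ := sum_multiset_natInd_le_card hC M hM'
      rw [← hv] at h₁
      simp only [Pi.add_apply, Finset.sum_add_distrib]
      omega) rfl
  refine ⟨S ::ₘ N, by simp [hNk, hMk], ?_, by simp [hNw, hw_eq]⟩
  intro T hT
  rcases Multiset.mem_cons.1 hT with rfl | hT
  · exact hM T (Multiset.mem_cons_self T M)
  · exact hN T hT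

/-- A sum of elements of a nonempty convex set is a multiple of an element of that set. -/
lemma Convex.exists_multiset_sum_eq_card_smul {E : Type*} [AddCommGroup E] [Module ℝ E]
    {P : Set E} (hP : Convex ℝ P) (hne : P.Nonempty) (M : Multiset E) (hM : ∀ v ∈ M, v ∈ P) :
    ∃ p ∈ P, M.sum = (M.card : ℝ) • p := by
  induction M using Multiset.induction_on with
  | empty =>
    obtain ⟨p, hp⟩ := hne
    exact ⟨p, hp, by simp⟩
  | cons v M ih =>
    obtain ⟨p, hp, hsum⟩ := ih fun u hu => hM u (Multiset.mem_cons_of_mem hu)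
    have h : (0 : ℝ) < M.card + 1 := by positivity
    refine ⟨(1 / (M.card + 1 : ℝ)) • v + (M.card / (M.card + 1 : ℝ)) • p,
      hP (hM v (Multiset.mem_cons_self v M)) hp (by positivity) (by positivity)
        (by field_simp; ring), ?_⟩
    rw [Multiset.sum_cons, hsum, Multiset.card_cons, smul_add, smul_smul, smul_smul]
    push_cast
    rw [mul_one_div_cancel h.ne', mul_div_cancel₀ _ h.ne', one_smul]

lemma isClosed_stableSetPolytope {d : ℕ} (G : SimpleGraph (Fin d)) :
    IsClosed (stableSetPolytope G) := by
  refine Set.Finite.isClosed_convexHull ℝ ?_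
  refine (Set.finite_range (indVec (d := d))).subset ?_
  rintro _ ⟨s, -, rfl⟩
  exact ⟨s, rfl⟩

/-- Integral weights whose clique weights are at most `k` lie in the `k`-th dilate of the stable
set polytope of a perfect graph. -/
lemma natCast_div_mem_stableSetPolytope {d : ℕ} {G : SimpleGraph (Fin d)} (hG : IsPerfect G)
    (w : Fin d → ℕ) {k : ℕ} (hk₀ : k ≠ 0)
    (hk : ∀ C : Finset (Fin d), G.IsClique (C : Set (Fin d)) → ∑ i ∈ C, w i ≤ k) :
    (fun i => (w i : ℝ) / k) ∈ stableSetPolytope G := by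
  obtain ⟨M, hMk, hM, hMw⟩ := exists_stable_decomposition hG w k hk
  have hmem : ∀ S, IsStableSet G S → indVec S ∈ stableSetPolytope G := fun S hS =>
    subset_convexHull ℝ _ ⟨S, hS, rfl⟩
  obtain ⟨p, hp, hsum⟩ := (convex_convexHull ℝ _ : Convex ℝ (stableSetPolytope G)
    ).exists_multiset_sum_eq_card_smul ⟨_, hmem ∅ (by simp [IsStableSet])⟩ (M.map indVec) (by
      intro v hv
      obtain ⟨S, hS, rfl⟩ := Multiset.mem_map.1 hv
      exact hmem S (hM S hS))
  have hcast : ∀ i, (w i : ℝ) = (M.map indVec).sum i := by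
    intro i
    rw [← hMw, Pi.multiset_sum_apply, Pi.multiset_sum_apply, Nat.cast_multiset_sum]
    simp [Multiset.map_map, Function.comp_def, natInd, indVec]
  suffices h : (fun i => (w i : ℝ) / k) = p from h ▸ hp
  ext i
  rw [hcast, hsum, Multiset.card_map, hMk, Pi.smul_apply, smul_eq_mul]
  field_simp

/-- Points of the stable set polytope satisfy the nonnegativity and clique inequalities. -/
lemma stableSetPolytope_subset {d : ℕ} (G : SimpleGraph (Fin d)) :
    stableSetPolytope G ⊆
      {x | x ∈ nonnegOrthant d ∧
        ∀ C : Finset (Fin d), G.IsClique (C : Set (Fin d)) → ∑ i ∈ C, x i ≤ 1} := by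
  refine convexHull_min ?_ ?_
  · rintro _ ⟨S, hS, rfl⟩
    refine ⟨fun i => ?_, fun C hC => ?_⟩
    · unfold indVec
      split_ifs <;> norm_num
    · have h : ((∑ i ∈ C, natInd S i : ℕ) : ℝ) ≤ 1 := by
        exact_mod_cast sum_natInd_le_one hS hC
      simpa [natInd, indVec] using h
  · rintro x ⟨hx, hxC⟩ y ⟨hy, hyC⟩ a b ha hb hab
    refine ⟨fun i => ?_, fun C hC => ?_⟩
    · exact add_nonneg (mul_nonneg ha (hx i)) (mul_nonneg hb (hy i))
    · simp only [Pi.add_apply, Pi.smul_apply, smul_eq_mul, Finset.sum_add_distrib,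
        ← Finset.mul_sum]
      have h₁ := mul_le_mul_of_nonneg_left (hxC C hC) ha
      have h₂ := mul_le_mul_of_nonneg_left (hyC C hC) hb
      linarith

/-- Lovász: for a perfect graph, the stable set polytope is cut
out by nonnegativity and the clique inequalities. -/
theorem stmt8 {d : ℕ} (G : SimpleGraph (Fin d)) (hG : IsPerfect G) :
    stableSetPolytope G =
      {x | x ∈ nonnegOrthant d ∧
        ∀ C : Finset (Fin d), G.IsClique (C : Set (Fin d)) → ∑ i ∈ C, x i ≤ 1} := by
  refine (stableSetPolytope_subset G).antisymm ?_
  rintro x ⟨hx, hxC⟩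
  have hlim : Filter.Tendsto (fun (n : ℕ) (i : Fin d) => (⌊x i * n⌋₊ : ℝ) / n) Filter.atTop
      (nhds x) :=
    tendsto_pi_nhds.2 fun i =>
      (tendsto_nat_floor_mul_div_atTop (hx i)).comp tendsto_natCast_atTop_atTop
  refine (isClosed_stableSetPolytope G).mem_of_tendsto hlim ?_
  filter_upwards [Filter.eventually_ne_atTop 0] with n hn
  refine natCast_div_mem_stableSetPolytope hG (fun i => ⌊x i * n⌋₊) hn fun C hC => ?_
  have h : (∑ i ∈ C, (⌊x i * n⌋₊ : ℝ)) ≤ n := calc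
    _ ≤ ∑ i ∈ C, x i * n :=
      Finset.sum_le_sum fun i _ => Nat.floor_le (mul_nonneg (hx i) n.cast_nonneg)
    _ = (∑ i ∈ C, x i) * n := by rw [Finset.sum_mul]
    _ ≤ 1 * n := mul_le_mul_of_nonneg_right (hxC C hC) n.cast_nonneg
    _ = n := one_mul _
  exact_mod_cast h
end

section
/- The h*-vector of a lattice polytope is monotone: if P ⊆ Q are lattice polytopes in ℝ^d, then 0 ≤ h*_i(P) ≤ h*_i(Q) for all 0 ≤ i ≤ d; consequently, any unconditional reflexive polytope P ⊂ ℝ^d satisfies binom(d,i) ≤ h*_i(P) ≤ B(d,i), where B(d,i) is the type-B Eulerian number (the h*-vector of [−1,1]^d) and binom(d,i) is the h*-vector entry of the crosspolytope. -/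
open Finset

/-- The Ehrhart counting function: number of lattice points of the `t`-th
dilate (with `0 • P = {0}` convention via `t = 0` giving the set `(0:ℝ) • P`). -/
noncomputable def ehr {d : ℕ} (P : Set (Fin d → ℝ)) (t : ℕ) : ℕ :=
  {z : Fin d → ℤ | intCast z ∈ (fun x => (t : ℝ) • x) '' P}.ncard

/-- The dimension of a set, as the rank of its vector span. -/
noncomputable def polyDim {d : ℕ} (P : Set (Fin d → ℝ)) : ℕ :=
  Module.finrank ℝ (vectorSpan ℝ P)

/-- The `i`-th entry of the `h^*`-vector of a lattice polytope `P`, via the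
closed formula `h^*_i = ∑_{j=0}^{i} (-1)^{i-j} binom(dim P + 1, i-j) ehr_P(j)`
(for `i > dim P` this is `0`, matching the zero-padding convention). -/
noncomputable def hstar {d : ℕ} (P : Set (Fin d → ℝ)) (i : ℕ) : ℤ :=
  ∑ j ∈ Finset.range (i + 1),
    (-1 : ℤ) ^ (i - j) * ((polyDim P + 1).choose (i - j) : ℤ) * (ehr P j : ℤ)

/-- The cube `[-1,1]^d`; its `h^*`-vector entries are the type-B Eulerian
numbers `B(d,i)`. -/
def cube (d : ℕ) : Set (Fin d → ℝ) := {x | ∀ i, |x i| ≤ 1}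


/-- A representation `c` of a vector as a nonnegative combination of the family `u` is reduced if
no infinitesimal change along a linear relation makes it lexicographically smaller. -/
def IsLexReduced {ι E : Type*} [Fintype ι] [LinearOrder ι] [AddCommGroup E] [Module ℝ E]
    (u : ι → E) (c : ι → ℝ) : Prop :=
  (∀ i, 0 ≤ c i) ∧
    ∀ d : ι → ℝ, ∑ i, d i • u i = 0 → toLex d < 0 → ∃ i, d i < 0 ∧ c i = 0

section Reduced

variable {ι E : Type*} [Fintype ι] [LinearOrder ι] [AddCommGroup E] [Module ℝ E] {u : ι → E}

theorem toLex_lt_zero_or_neg {d : ι → ℝ} (hd : d ≠ 0) : toLex d < 0 ∨ toLex (-d) < 0 := by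
  rcases lt_trichotomy (toLex d) 0 with h | h | h
  · exact .inl h
  · exact absurd h hd
  · exact .inr (by rw [toLex_neg]; exact neg_lt_zero.2 h)

theorem IsLexReduced.mono {c c' : ι → ℝ} (h : IsLexReduced u c) (hc' : ∀ i, 0 ≤ c' i)
    (hs : ∀ i, c i = 0 → c' i = 0) : IsLexReduced u c' :=
  ⟨hc', fun d hd hlt => (h.2 d hd hlt).imp fun _ hi => ⟨hi.1, hs _ hi.2⟩⟩

theorem IsLexReduced.unique {c c' : ι → ℝ} (h : IsLexReduced u c) (h' : IsLexReduced u c')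
    (hs : ∑ i, c i • u i = ∑ i, c' i • u i) : c = c' := by
  by_contra hne
  have key : ∀ {a b : ι → ℝ}, IsLexReduced u a → IsLexReduced u b →
      ∑ i, a i • u i = ∑ i, b i • u i → ¬ toLex (a - b) < 0 := by
    intro a b ha hb hab hlt
    obtain ⟨i, hi, hi'⟩ := hb.2 (a - b)
      (by simp [sub_smul, Finset.sum_sub_distrib, hab]) hlt
    have := ha.1 i
    simp only [Pi.sub_apply] at hi
    linarith
  rcases toLex_lt_zero_or_neg (sub_ne_zero.2 hne) with hlt | hlt
  · exact key h h' hs hlt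
  · rw [neg_sub] at hlt
    exact key h' h hs.symm hlt

theorem IsLexReduced.eq_zero_of_relation {c d : ι → ℝ} (h : IsLexReduced u c)
    (hd : ∑ i, d i • u i = 0) (hs : ∀ i, c i = 0 → d i = 0) : d = 0 := by
  by_contra hne
  rcases toLex_lt_zero_or_neg hne with hlt | hlt
  · obtain ⟨i, hi, hi'⟩ := h.2 d hd hlt
    exact hi.ne (hs i hi')
  · obtain ⟨i, hi, hi'⟩ := h.2 (-d) (by simp [hd]) hlt
    simp [hs i hi'] at hi

theorem toLex_smul_neg {κ : Type*} [LinearOrder κ] {d : κ → ℝ} (hd : toLex d < 0) {ε : ℝ} (hε : 0 < ε) :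
    toLex (ε • d) < 0 := by
  obtain ⟨i, hi, hi'⟩ := hd
  refine ⟨i, fun j hj => ?_, ?_⟩
  · have : d j = 0 := hi j hj
    change ε * d j = 0
    simp [this]
  · exact mul_neg_of_pos_of_neg hε hi'

theorem exists_pos_add_smul_nonneg {κ : Type*} [Finite κ] {c d : κ → ℝ} (hc : ∀ i, 0 ≤ c i)
    (h : ∀ i, d i < 0 → c i ≠ 0) : ∃ ε > 0, ∀ i, 0 ≤ c i + ε * d i := by
  have key : ∀ᶠ ε in nhdsWithin (0 : ℝ) (Set.Ioi 0), ∀ i, 0 ≤ c i + ε * d i := by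
    refine Filter.eventually_all.2 fun i => ?_
    by_cases hdi : d i < 0
    · have : Filter.Tendsto (fun ε : ℝ => c i + ε * d i) (nhdsWithin 0 (Set.Ioi 0))
          (nhds (c i + 0 * d i)) :=
        (Continuous.tendsto (by fun_prop) 0).mono_left nhdsWithin_le_nhds
      have hpos : 0 < c i + 0 * d i := by
        simpa using lt_of_le_of_ne (hc i) (h i hdi).symm
      exact (this.eventually (lt_mem_nhds hpos)).mono fun _ h => h.le
    · filter_upwards [self_mem_nhdsWithin] with ε hε
      exact add_nonneg (hc i) (mul_nonneg (le_of_lt hε) (not_lt.1 hdi))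
  obtain ⟨ε, h1, h2⟩ := ((eventually_mem_nhdsWithin (s := Set.Ioi (0 : ℝ))).and key).exists
  exact ⟨ε, h1, h2⟩

/-- Lexicographic version of Carathéodory's theorem for cones. -/
theorem exists_independent_le (n : ℕ) (c : ι → ℝ) (hc : ∀ i, 0 ≤ c i)
    (hn : (Finset.univ.filter fun i => c i ≠ 0).card ≤ n) :
    ∃ c' : ι → ℝ, (∀ i, 0 ≤ c' i) ∧ ∑ i, c' i • u i = ∑ i, c i • u i ∧ toLex c' ≤ toLex c ∧
      ∀ d : ι → ℝ, ∑ i, d i • u i = 0 → (∀ i, c' i = 0 → d i = 0) → d = 0 := by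
  induction n generalizing c with
  | zero =>
    refine ⟨c, hc, rfl, le_rfl, fun d _ h => funext fun i => h i ?_⟩
    by_contra hi
    simp only [nonpos_iff_eq_zero, Finset.card_eq_zero] at hn
    have : i ∈ (Finset.univ.filter fun i => c i ≠ 0) := by simpa using hi
    simp [hn] at this
  | succ n ih =>
    by_cases hind : ∀ d : ι → ℝ, ∑ i, d i • u i = 0 → (∀ i, c i = 0 → d i = 0) → d = 0
    · exact ⟨c, hc, rfl, le_rfl, hind⟩
    obtain ⟨d, hd, hs, hlt⟩ : ∃ d : ι → ℝ, ∑ i, d i • u i = 0 ∧ (∀ i, c i = 0 → d i = 0) ∧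
        toLex d < 0 := by
      push Not at hind
      obtain ⟨d, hd, hs, hne⟩ := hind
      rcases toLex_lt_zero_or_neg hne with h | h
      · exact ⟨d, hd, hs, h⟩
      · exact ⟨-d, by simp [hd], fun i hi => by simp [hs i hi], h⟩
    obtain ⟨i₀, -, hi₀⟩ := id hlt
    have hne : (Finset.univ.filter fun i => d i < 0).Nonempty := ⟨i₀, Finset.mem_filter.2 ⟨Finset.mem_univ _, hi₀⟩⟩
    obtain ⟨k, hk, hmin⟩ := Finset.exists_min_image _ (fun i => c i / (-d i)) hne
    simp only [Finset.mem_filter, Finset.mem_univ, true_and] at hk hmin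
    have hck : 0 < c k := lt_of_le_of_ne (hc k) fun h => hk.ne (hs k h.symm)
    set ε := c k / (-d k) with hε
    have hεpos : 0 < ε := div_pos hck (neg_pos.2 hk)
    have hnn : ∀ i, 0 ≤ (c + ε • d) i := by
      intro i
      simp only [Pi.add_apply, Pi.smul_apply, smul_eq_mul]
      rcases lt_or_ge (d i) 0 with hi | hi
      · have h1 := hmin i hi
        rw [le_div_iff₀ (neg_pos.2 hi)] at h1
        linarith
      · exact add_nonneg (hc i) (mul_nonneg hεpos.le hi)
    have hk0 : (c + ε • d) k = 0 := by
      simp only [Pi.add_apply, Pi.smul_apply, smul_eq_mul, hε]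
      field_simp [hk.ne]
      ring
    obtain ⟨c', h1, h2, h3, h4⟩ := ih (c + ε • d) hnn (by
      refine Nat.le_of_lt_succ (lt_of_lt_of_le (Finset.card_lt_card ?_) hn)
      refine Finset.ssubset_iff_of_subset ?_ |>.2 ⟨k, by simpa using hck.ne', by simpa using hk0⟩
      intro i
      simp only [Finset.mem_filter, Finset.mem_univ, true_and, Pi.add_apply, Pi.smul_apply]
      intro h hi
      simp [hi, hs i hi] at h)
    refine ⟨c', h1, ?_, h3.trans ?_, h4⟩
    · rw [h2]
      simp only [Pi.add_apply, Pi.smul_apply, add_smul, Finset.sum_add_distrib, smul_assoc,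
        ← Finset.smul_sum, hd, smul_zero, add_zero]
    · rw [toLex_add]
      exact (add_lt_of_neg_right _ (toLex_smul_neg hlt hεpos)).le

theorem exists_isLexReduced (c : ι → ℝ) (hc : ∀ i, 0 ≤ c i) :
    ∃ c' : ι → ℝ, IsLexReduced u c' ∧ ∑ i, c' i • u i = ∑ i, c i • u i ∧ toLex c' ≤ toLex c := by
  let S : Set (Lex (ι → ℝ)) := {x | (∀ i, 0 ≤ ofLex x i) ∧
    ∑ i, ofLex x i • u i = ∑ i, c i • u i ∧
      ∀ d : ι → ℝ, ∑ i, d i • u i = 0 → (∀ i, ofLex x i = 0 → d i = 0) → d = 0}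
  have hmem : ∀ b : ι → ℝ, (∀ i, 0 ≤ b i) → ∑ i, b i • u i = ∑ i, c i • u i →
      ∃ x ∈ S, x ≤ toLex b := by
    intro b hb hbs
    obtain ⟨c', h1, h2, h3, h4⟩ := exists_independent_le (u := u) _ b hb le_rfl
    exact ⟨toLex c', ⟨h1, h2.trans hbs, h4⟩, h3⟩
  have hfin : S.Finite := by
    refine Set.Finite.of_injOn (f := fun x : Lex (ι → ℝ) => (Finset.univ.filter fun i => ofLex x i ≠ 0))
      (t := Set.univ) (fun _ _ => Set.mem_univ _) ?_ Set.finite_univ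
    intro x hx y hy hxy
    have h0 : ofLex x - ofLex y = 0 := by
      refine hx.2.2 _ (by
        simp only [Pi.sub_apply, sub_smul, Finset.sum_sub_distrib]
        exact sub_eq_zero.2 (hx.2.1.trans hy.2.1.symm)) fun i hi => ?_
      have : ofLex y i = 0 := by
        have := Finset.ext_iff.1 hxy i
        simp only [Finset.mem_filter, Finset.mem_univ, true_and] at this
        tauto
      simp [hi, this]
    exact sub_eq_zero.1 h0
  obtain ⟨x₀, hx₀, hle₀⟩ := hmem c hc rfl
  obtain ⟨m, hm, hmin⟩ := Set.exists_min_image S id hfin ⟨x₀, hx₀⟩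
  refine ⟨ofLex m, ⟨hm.1, fun d hd hlt => ?_⟩, hm.2.1, (hmin x₀ hx₀).trans hle₀⟩
  by_contra! hcon
  obtain ⟨ε, hε, hnn⟩ := exists_pos_add_smul_nonneg hm.1 hcon
  obtain ⟨y, hy, hyle⟩ := hmem (ofLex m + ε • d) hnn (by
    rw [← hm.2.1]
    simp only [Pi.add_apply, Pi.smul_apply, add_smul, Finset.sum_add_distrib, smul_assoc,
        ← Finset.smul_sum, hd, smul_zero, add_zero])
  refine absurd (hmin y hy) (not_le.2 (hyle.trans_lt ?_))
  rw [toLex_add]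
  exact add_lt_of_neg_right _ (toLex_smul_neg hlt hε)

theorem exists_isLexReduced_of_isUpperSet {K : Set ι} (hK : IsUpperSet K) (c : ι → ℝ)
    (hc : ∀ i, 0 ≤ c i) (hcK : ∀ i ∉ K, c i = 0) :
    ∃ c' : ι → ℝ, IsLexReduced u c' ∧ (∀ i ∉ K, c' i = 0) ∧
      ∑ i, c' i • u i = ∑ i, c i • u i := by
  obtain ⟨c', h1, h2, h3⟩ := exists_isLexReduced (u := u) c hc
  refine ⟨c', h1, ?_, h2⟩
  rcases h3.eq_or_lt with h | ⟨i, hi, hlt⟩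
  · rwa [toLex_inj.1 h]
  · have hiK : i ∈ K := by
      by_contra hiK
      have h4 : c i = 0 := hcK i hiK
      have h5 := h1.1 i
      have h6 : c' i < c i := hlt
      linarith
    intro j hj
    have hji : j < i := lt_of_not_ge fun h => hj (hK h hiK)
    exact (hi j hji).trans (hcK j hj)

end Reduced

section Counting

variable {ι E Λ : Type*} [Fintype ι] [LinearOrder ι] [AddCommGroup E] [Module ℝ E]
  [AddCommGroup Λ]

/-- The lattice points whose translate by `q` lies in the cone over the `a i` with `i ∈ K`. -/
def shiftedCone (φ : Λ →+ E) (a : ι → Λ) (K : Set ι) (q : E) : Set Λ :=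
  {z | ∃ c, IsLexReduced (fun i => φ (a i)) c ∧ (∀ i ∉ K, c i = 0) ∧
    ∑ i, c i • φ (a i) = φ z + q}

/-- The points of `shiftedCone` whose reduced representation has coefficients at most one. -/
def boxPoints (φ : Λ →+ E) (a : ι → Λ) (K : Set ι) (q : E) : Set Λ :=
  {z | ∃ c, IsLexReduced (fun i => φ (a i)) c ∧ (∀ i ∉ K, c i = 0) ∧
    ∑ i, c i • φ (a i) = φ z + q ∧ ∀ i, c i ≤ 1}

theorem sub_ceil_pred_bounds {x : ℝ} (hx : 0 ≤ x) :
    0 ≤ x - ((⌈x⌉₊ - 1 : ℕ) : ℝ) ∧ x - ((⌈x⌉₊ - 1 : ℕ) : ℝ) ≤ 1 ∧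
      (x - ((⌈x⌉₊ - 1 : ℕ) : ℝ) = 0 ↔ x = 0) := by
  rcases hx.eq_or_lt with rfl | h
  · simp
  · have h1 : 1 ≤ ⌈x⌉₊ := Nat.one_le_ceil_iff.2 h
    rw [Nat.cast_sub h1, Nat.cast_one]
    have h2 := Nat.ceil_lt_add_one hx
    have h3 := Nat.le_ceil x
    refine ⟨by linarith, by linarith, fun h4 => by linarith, fun h4 => by linarith⟩

theorem ceil_add_natCast_pred {x : ℝ} (hx : 0 ≤ x) (hx1 : x ≤ 1) {n : ℕ} (hn : x = 0 → n = 0) :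
    ⌈x + n⌉₊ - 1 = n := by
  rcases hx.eq_or_lt with h | h
  · simp [hn h.symm, ← h]
  · have : ⌈x⌉₊ = 1 := le_antisymm (Nat.ceil_le.2 (by simpa using hx1)) (Nat.one_le_ceil_iff.2 h)
    rw [Nat.ceil_add_natCast hx, this]
    omega

theorem card_shiftedCone (φ : Λ →+ E) (ht : Λ →+ ℤ) (a : ι → Λ) (ha : ∀ i, ht (a i) = 1)
    (K : Set ι) (q : E) (D t : ℕ) (hnn : ∀ z ∈ shiftedCone φ a K q, 0 ≤ ht z)
    (hfin : ∀ k : ℕ, {z ∈ shiftedCone φ a K q | ht z = k}.Finite)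
    (hcard : ∀ z ∈ shiftedCone φ a K q, ht z ≤ t → ∀ c, IsLexReduced (fun i => φ (a i)) c →
      (∀ i ∉ K, c i = 0) → ∑ i, c i • φ (a i) = φ z + q →
        (Finset.univ.filter fun i => c i ≠ 0).card = D + 1) :
    {z ∈ shiftedCone φ a K q | ht z = t}.ncard =
      ∑ k ∈ Finset.range (t + 1),
        {z ∈ boxPoints φ a K q | ht z = k}.ncard * (D + (t - k)).choose D := by
  classical
  have hex : ∀ z, ∃ c, z ∈ shiftedCone φ a K q → IsLexReduced (fun i => φ (a i)) c ∧
      (∀ i ∉ K, c i = 0) ∧ ∑ i, c i • φ (a i) = φ z + q := by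
    intro z
    by_cases hz : z ∈ shiftedCone φ a K q
    · obtain ⟨c, hc⟩ := hz
      exact ⟨c, fun _ => hc⟩
    · exact ⟨0, fun h => absurd h hz⟩
  choose g hg using hex
  have hguniq : ∀ z c, IsLexReduced (fun i => φ (a i)) c → (∀ i ∉ K, c i = 0) →
      ∑ i, c i • φ (a i) = φ z + q → z ∈ shiftedCone φ a K q ∧ g z = c := by
    intro z c h1 h2 h3
    have hz : z ∈ shiftedCone φ a K q := ⟨c, h1, h2, h3⟩
    exact ⟨hz, (hg z hz).1.unique h1 ((hg z hz).2.2.trans h3.symm)⟩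
  have hBX : boxPoints φ a K q ⊆ shiftedCone φ a K q :=
    fun z ⟨c, h1, h2, h3, _⟩ => ⟨c, h1, h2, h3⟩
  have hB1 : ∀ z ∈ boxPoints φ a K q, ∀ i, g z i ≤ 1 := by
    rintro z ⟨c, h1, h2, h3, h4⟩
    rw [(hguniq z c h1 h2 h3).2]
    exact h4
  let w : (ι →₀ ℕ) → Λ := fun f => ∑ i, f i • a i
  have hw : ∀ f, ht (w f) = ∑ i, (f i : ℤ) := by
    intro f
    simp [w, ha]
  have hwφ : ∀ f, φ (w f) = ∑ i, (f i : ℝ) • φ (a i) := by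
    intro f
    simp [w, Nat.cast_smul_eq_nsmul]
  let e : Λ → (ι →₀ ℕ) := fun z => Finsupp.equivFunOnFinite.symm fun i => ⌈g z i⌉₊ - 1
  have he : ∀ z i, e z i = ⌈g z i⌉₊ - 1 := fun z i => rfl
  have hadd : ∀ b ∈ boxPoints φ a K q, ∀ f : ι →₀ ℕ, (∀ i, g b i = 0 → f i = 0) →
      b + w f ∈ shiftedCone φ a K q ∧ e (b + w f) = f := by
    intro b hb f hf
    obtain ⟨h1, h2, h3⟩ := hg b (hBX hb)
    obtain ⟨h4, h5⟩ := hguniq (b + w f) (fun i => g b i + f i)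
      (h1.mono (fun i => add_nonneg (h1.1 i) (Nat.cast_nonneg _))
        fun i hi => by simp [hi, hf i hi])
      (fun i hi => by simp [h2 i hi, hf i (h2 i hi)])
      (by simp only [add_smul, Finset.sum_add_distrib, h3, map_add, hwφ]; abel)
    refine ⟨h4, Finsupp.ext fun i => ?_⟩
    rw [he, h5]
    exact ceil_add_natCast_pred (h1.1 i) (hB1 b hb i) (hf i)
  have hsub : ∀ z ∈ shiftedCone φ a K q, z - w (e z) ∈ boxPoints φ a K q ∧
      ∀ i, g (z - w (e z)) i = 0 ↔ g z i = 0 := by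
    intro z hz
    obtain ⟨h1, h2, h3⟩ := hg z hz
    have hbd := fun i => sub_ceil_pred_bounds (h1.1 i)
    have h4 : IsLexReduced (fun i => φ (a i)) fun i => g z i - (e z i : ℝ) :=
      h1.mono (fun i => (hbd i).1) fun i hi => (hbd i).2.2.2 hi
    have h5 : ∀ i ∉ K, g z i - (e z i : ℝ) = 0 := fun i hi => (hbd i).2.2.2 (h2 i hi)
    have h6 : ∑ i, (g z i - (e z i : ℝ)) • φ (a i) = φ (z - w (e z)) + q := by
      simp only [sub_smul, Finset.sum_sub_distrib, h3, map_sub, hwφ]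
      abel
    refine ⟨⟨_, h4, h5, h6, fun i => (hbd i).2.1⟩, fun i => ?_⟩
    rw [(hguniq _ _ h4 h5 h6).2]
    exact (hbd i).2.2
  have hBfin : ∀ k : ℕ, {z ∈ boxPoints φ a K q | ht z = k}.Finite := fun k =>
    (hfin k).subset fun z hz => ⟨hBX hz.1, hz.2⟩
  let supp : Λ → Finset ι := fun z => Finset.univ.filter fun i => g z i ≠ 0
  have hbij : (hfin t).toFinset.card = ((Finset.range (t + 1)).sigma fun k : ℕ =>
      (hBfin k).toFinset.sigma fun b => (supp b).finsuppAntidiag (t - k)).card := by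
    refine Finset.card_nbij' (fun z => ⟨(ht (z - w (e z))).toNat, z - w (e z), e z⟩)
      (fun p => p.2.1 + w p.2.2) ?_ ?_ ?_ ?_
    · intro z hz
      simp only [Set.Finite.coe_toFinset, Set.mem_ofPred_eq] at hz
      obtain ⟨hb, hb0⟩ := hsub z hz.1
      have h0 := hnn _ (hBX hb)
      have hht : ht (z - w (e z)) = t - ∑ i, (e z i : ℤ) := by rw [map_sub, hw, hz.2]
      have hs : ∑ i ∈ supp (z - w (e z)), e z i = ∑ i, e z i := by
        refine Finset.sum_subset (Finset.subset_univ _) fun i _ hi => ?_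
        have : g z i = 0 := by simpa [supp, hb0] using hi
        simp [he, this]
      have hcast : ((∑ i, e z i : ℕ) : ℤ) = ∑ i, (e z i : ℤ) := by push_cast; rfl
      simp only [Finset.coe_sigma, Set.mem_sigma_iff, Finset.mem_coe, Finset.mem_range,
        Set.Finite.mem_toFinset, Set.mem_ofPred_eq, Finset.mem_finsuppAntidiag, hs]
      refine ⟨by omega, ⟨hb, by omega⟩, by omega, fun i hi => ?_⟩
      have hi' : e z i ≠ 0 := Finsupp.mem_support_iff.1 hi
      simp only [supp, Finset.mem_filter, Finset.mem_univ, true_and, ne_eq, hb0]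
      exact fun h => hi' (by simp [he, h])
    · rintro ⟨k, b, f⟩ hp
      simp only [Finset.coe_sigma, Set.mem_sigma_iff, Finset.mem_coe, Finset.mem_range,
        Set.Finite.mem_toFinset, Set.mem_ofPred_eq, Finset.mem_finsuppAntidiag] at hp
      obtain ⟨hk, ⟨hb, hbk⟩, hf, hfs⟩ := hp
      have hf0 : ∀ i, g b i = 0 → f i = 0 := by
        intro i hi
        by_contra h
        have := hfs (Finsupp.mem_support_iff.2 h)
        simp [supp, hi] at this
      simp only [Set.Finite.coe_toFinset, Set.mem_ofPred_eq]
      refine ⟨(hadd b hb f hf0).1, ?_⟩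
      have hs : ∑ i ∈ supp b, f i = ∑ i, f i := by
        refine Finset.sum_subset (Finset.subset_univ _) fun i _ hi => hf0 i ?_
        simpa [supp] using hi
      have hcast : ((∑ i, f i : ℕ) : ℤ) = ∑ i, (f i : ℤ) := by push_cast; rfl
      have hsum : ∑ i, f i = t - k := hs.symm.trans hf
      rw [map_add, hw, hbk]
      omega
    · intro z _
      simp
    · rintro ⟨k, b, f⟩ hp
      simp only [Finset.coe_sigma, Set.mem_sigma_iff, Finset.mem_coe, Finset.mem_range,
        Set.Finite.mem_toFinset, Set.mem_ofPred_eq, Finset.mem_finsuppAntidiag] at hp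
      obtain ⟨hk, ⟨hb, hbk⟩, hf, hfs⟩ := hp
      have hf0 : ∀ i, g b i = 0 → f i = 0 := by
        intro i hi
        by_contra h
        have := hfs (Finsupp.mem_support_iff.2 h)
        simp [supp, hi] at this
      simp [(hadd b hb f hf0).2, hbk]
  rw [Set.ncard_eq_toFinset_card _ (hfin t), hbij, Finset.card_sigma]
  refine Finset.sum_congr rfl fun k hk => ?_
  rw [Finset.card_sigma, Set.ncard_eq_toFinset_card _ (hBfin k), ← smul_eq_mul,
    ← Finset.sum_const]
  refine Finset.sum_congr rfl fun b hb => ?_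
  simp only [Set.Finite.mem_toFinset, Set.mem_ofPred_eq] at hb
  obtain ⟨h1, h2, h3⟩ := hg b (hBX hb.1)
  have hle : ht b ≤ t := by
    have := Finset.mem_range.1 hk
    omega
  rw [Finset.card_finsuppAntidiag_nat_eq_choose, hcard b (hBX hb.1) hle _ h1 h2 h3]
  rw [show D + 1 + (t - k) - 1 = D + (t - k) by omega, Nat.choose_symm_add]

end Counting

section Perturbation

open Filter Topology

theorem eventually_add_perturbation_notMem {E : Type*} [AddCommGroup E] [Module ℝ E] {n : ℕ}
    (u : Fin n → E) (J : Finset (Fin n)) (p : Submodule ℝ E) (x : E)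
    (hJ : ∃ j ∈ J, u j ∉ p) :
    ∀ᶠ η : ℝ in 𝓝[>] 0, x + ∑ i ∈ J, η ^ (i.1 + 1) • u i ∉ p := by
  obtain ⟨j, hj, hjp⟩ := hJ
  obtain ⟨f, hfj, hpf⟩ := Submodule.exists_le_ker_of_notMem hjp
  let P : Polynomial ℝ := Polynomial.C (f x) +
    ∑ i ∈ J, Polynomial.monomial (i.1 + 1) (f (u i))
  have hP : P ≠ 0 := by
    intro h
    have h1 : P.coeff (j.1 + 1) = f (u j) := by
      simp only [P, Polynomial.coeff_add, Polynomial.finsetSum_coeff, Polynomial.coeff_monomial,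
        Polynomial.coeff_C_succ, zero_add]
      rw [Finset.sum_eq_single j]
      · simp
      · intro i _ hij
        rw [if_neg fun h => hij (Fin.ext (by omega))]
      · exact fun h => absurd hj h
    rw [h, Polynomial.coeff_zero] at h1
    exact hfj h1.symm
  have hfin : ((P.roots.toFinset : Set ℝ) \ {0}).Finite := (Finset.finite_toSet _).subset
    Set.sdiff_subset
  have hnhds : ((P.roots.toFinset : Set ℝ) \ {0})ᶜ ∈ 𝓝 (0 : ℝ) :=
    hfin.isClosed.isOpen_compl.mem_nhds (by simp)
  filter_upwards [mem_nhdsWithin_of_mem_nhds hnhds, self_mem_nhdsWithin] with η h1 h2 h3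
  refine h1 ⟨?_, (ne_of_gt h2 : η ≠ 0)⟩
  have h4 : f (x + ∑ i ∈ J, η ^ (i.1 + 1) • u i) = 0 := hpf h3
  rw [Finset.mem_coe, Multiset.mem_toFinset, Polynomial.mem_roots hP, Polynomial.IsRoot.def]
  simp only [P, Polynomial.eval_add, Polynomial.eval_C, Polynomial.eval_finsetSum,
    Polynomial.eval_monomial]
  rw [← h4, map_add, map_sum]
  simp [mul_comm]

theorem IsLexReduced.card_support_eq {ι E : Type*} [Fintype ι] [LinearOrder ι] [AddCommGroup E]
    [Module ℝ E] {u : ι → E} {c : ι → ℝ} (h : IsLexReduced u c) {J K : Set ι}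
    (hc : ∀ i ∉ K, c i = 0) (hJK : Submodule.span ℝ (u '' K) = Submodule.span ℝ (u '' J))
    (hgen : ∀ σ : Finset ι, (∃ j ∈ J, u j ∉ Submodule.span ℝ (u '' (σ : Set ι))) →
      ∑ i, c i • u i ∉ Submodule.span ℝ (u '' (σ : Set ι))) :
    (Finset.univ.filter fun i => c i ≠ 0).card =
      Module.finrank ℝ (Submodule.span ℝ (u '' J)) := by
  set σ := Finset.univ.filter fun i => c i ≠ 0 with hσ
  have hmem : ∑ i, c i • u i ∈ Submodule.span ℝ (u '' (σ : Set ι)) := by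
    refine Submodule.sum_mem _ fun i _ => ?_
    by_cases hi : c i = 0
    · simp [hi]
    · exact Submodule.smul_mem _ _ (Submodule.subset_span ⟨i, by simpa [hσ] using hi, rfl⟩)
  have hspan : Submodule.span ℝ (u '' (σ : Set ι)) = Submodule.span ℝ (u '' J) := by
    refine le_antisymm ?_ ?_
    · rw [← hJK]
      refine Submodule.span_mono (Set.image_mono fun i hi => ?_)
      by_contra hiK
      simp [hσ, hc i hiK] at hi
    · rw [Submodule.span_le]
      rintro _ ⟨j, hj, rfl⟩
      by_contra hjp
      exact hgen σ ⟨j, hj, hjp⟩ hmem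
  have hli : LinearIndepOn ℝ u (σ : Set ι) := by
    rw [linearIndepOn_finset_iff]
    intro f hf i hi
    classical
    have h0 := h.eq_zero_of_relation (d := fun i => if i ∈ σ then f i else 0)
      (by simpa [Finset.sum_ite_mem] using hf) (fun i hi => by simp [hσ, hi])
    simpa [hi] using congrFun h0 i
  rw [← hspan, Set.image_eq_range]
  have := finrank_span_eq_card (R := ℝ) hli
  rw [this]
  simp

/-- The embedding of the integer lattice in homogeneous coordinates. -/
def latticeEmb (d : ℕ) : (Fin d → ℤ) × ℤ →+ (Fin d → ℝ) × ℝ :=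
  AddMonoidHom.mk' (fun z => (intCast z.1, (z.2 : ℝ))) fun x y => by
    ext <;> simp [intCast]

theorem latticeEmb_apply {d : ℕ} (z : (Fin d → ℤ) × ℤ) :
    latticeEmb d z = (intCast z.1, (z.2 : ℝ)) := rfl

theorem finite_norm_latticeEmb_le (d : ℕ) (R : ℝ) : {z | ‖latticeEmb d z‖ ≤ R}.Finite := by
  refine ((Set.finite_Icc (fun _ => -⌈R⌉ : Fin d → ℤ) fun _ => ⌈R⌉).prod
    (Set.finite_Icc (-⌈R⌉) ⌈R⌉)).subset fun z hz => ?_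
  have h1 : ‖latticeEmb d z‖ ≤ R := hz
  have key : ∀ m : ℤ, |(m : ℝ)| ≤ R → -⌈R⌉ ≤ m ∧ m ≤ ⌈R⌉ := by
    intro m hm
    have h2 := (abs_le.1 (hm.trans (Int.le_ceil R)))
    exact ⟨by exact_mod_cast h2.1, by exact_mod_cast h2.2⟩
  have h2 : ∀ i, |(z.1 i : ℝ)| ≤ R := fun i =>
    ((norm_le_pi_norm (intCast z.1) i).trans (norm_fst_le (latticeEmb d z))).trans h1
  have h3 : |(z.2 : ℝ)| ≤ R := (norm_snd_le (latticeEmb d z)).trans h1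
  exact ⟨⟨fun i => (key _ (h2 i)).1, fun i => (key _ (h2 i)).2⟩, key _ h3⟩

variable {d n : ℕ} {a : Fin n → (Fin d → ℤ) × ℤ}

theorem sum_eq_of_combination (ha : ∀ i, (a i).2 = 1) {c : Fin n → ℝ} {x : (Fin d → ℝ) × ℝ}
    (h : ∑ i, c i • latticeEmb d (a i) = x) : ∑ i, c i = x.2 := by
  rw [← h, Prod.snd_sum]
  simp [latticeEmb_apply, ha]

theorem norm_combination_le {c : Fin n → ℝ} {S : ℝ} (hc : ∀ i, 0 ≤ c i) (hS : ∀ i, c i ≤ S) :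
    ‖∑ i, c i • latticeEmb d (a i)‖ ≤ S * ∑ i, ‖latticeEmb d (a i)‖ := by
  rw [Finset.mul_sum]
  refine (norm_sum_le _ _).trans (Finset.sum_le_sum fun i _ => ?_)
  rw [norm_smul, Real.norm_of_nonneg (hc i)]
  exact mul_le_mul_of_nonneg_right (hS i) (norm_nonneg _)

theorem norm_le_of_mem_shiftedCone (ha : ∀ i, (a i).2 = 1) {K : Set (Fin n)}
    {q : (Fin d → ℝ) × ℝ} {z : (Fin d → ℤ) × ℤ} (hz : z ∈ shiftedCone (latticeEmb d) a K q) :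
    0 ≤ z.2 + q.2 ∧
      ‖latticeEmb d z‖ ≤ (z.2 + q.2) * ∑ i, ‖latticeEmb d (a i)‖ + ‖q‖ := by
  obtain ⟨c, h1, h2, h3⟩ := hz
  have h4 : ∑ i, c i = z.2 + q.2 := sum_eq_of_combination ha h3
  refine ⟨h4 ▸ Finset.sum_nonneg fun i _ => h1.1 i, ?_⟩
  have h5 := norm_combination_le (a := a) h1.1 (S := z.2 + q.2) fun i =>
    h4 ▸ Finset.single_le_sum (fun j _ => h1.1 j) (Finset.mem_univ i)
  rw [h3] at h5
  calc ‖latticeEmb d z‖ = ‖(latticeEmb d z + q) - q‖ := by rw [add_sub_cancel_right]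
    _ ≤ ‖latticeEmb d z + q‖ + ‖q‖ := norm_sub_le _ _
    _ ≤ _ := by gcongr

theorem finite_shiftedCone_height (ha : ∀ i, (a i).2 = 1) (K : Set (Fin n))
    (q : (Fin d → ℝ) × ℝ) (k : ℤ) :
    {z ∈ shiftedCone (latticeEmb d) a K q | z.2 = k}.Finite :=
  (finite_norm_latticeEmb_le d ((k + q.2) * ∑ i, ‖latticeEmb d (a i)‖ + ‖q‖)).subset
    fun z hz => by
      have := (norm_le_of_mem_shiftedCone ha hz.1).2
      rwa [hz.2] at this

/-- A vector in the cone over the `a i` with `i ∈ J` that is generic for small `η`. -/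
noncomputable def perturbation (a : Fin n → (Fin d → ℤ) × ℤ) (J : Finset (Fin n)) (η : ℝ) :
    (Fin d → ℝ) × ℝ :=
  ∑ i ∈ J, η ^ (i.1 + 1) • latticeEmb d (a i)

theorem tendsto_perturbation (a : Fin n → (Fin d → ℤ) × ℤ) (J : Finset (Fin n)) :
    Tendsto (perturbation a J) (𝓝[>] 0) (𝓝 0) := by
  have h : Continuous (perturbation a J) := by unfold perturbation; fun_prop
  have h0 : perturbation a J 0 = 0 := by simp [perturbation]
  exact h0 ▸ (h.tendsto 0).mono_left nhdsWithin_le_nhds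

theorem eventually_card_shiftedCone (ha : ∀ i, (a i).2 = 1) {J K : Finset (Fin n)} (hJK : J ⊆ K)
    (hK : IsUpperSet (K : Set (Fin n)))
    (hspan : Submodule.span ℝ ((fun i => latticeEmb d (a i)) '' K) =
      Submodule.span ℝ ((fun i => latticeEmb d (a i)) '' J))
    {D : ℕ} (hD : Module.finrank ℝ
      (Submodule.span ℝ ((fun i => latticeEmb d (a i)) '' (J : Set (Fin n)))) = D + 1) (H : ℕ) :
    ∀ᶠ η : ℝ in 𝓝[>] 0, ∀ t ≤ H,
      {z : (Fin d → ℤ) × ℤ | z.2 = t ∧ ∃ c : Fin n → ℝ, (∀ i, 0 ≤ c i) ∧ (∀ i ∉ K, c i = 0) ∧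
        ∑ i, c i • latticeEmb d (a i) = latticeEmb d z}.ncard =
      ∑ k ∈ Finset.range (t + 1),
        {z ∈ boxPoints (latticeEmb d) a K (perturbation a J η) | z.2 = k}.ncard *
          (D + (t - k)).choose D := by
  let u : Fin n → (Fin d → ℝ) × ℝ := fun i => latticeEmb d (a i)
  let R : ℝ := (H + 1) * ∑ i, ‖u i‖ + 1
  have hZ := finite_norm_latticeEmb_le d R
  have hnorm : ∀ᶠ η : ℝ in 𝓝[>] 0, ‖perturbation a J η‖ < 1 := by
    have := (tendsto_perturbation a J).norm
    rw [norm_zero] at this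
    exact this.eventually (gt_mem_nhds one_pos)
  have hgen : ∀ᶠ η : ℝ in 𝓝[>] 0, ∀ z ∈ {z | ‖latticeEmb d z‖ ≤ R}, ∀ σ : Finset (Fin n),
      (∃ j ∈ J, u j ∉ Submodule.span ℝ (u '' (σ : Set (Fin n)))) →
        latticeEmb d z + perturbation a J η ∉ Submodule.span ℝ (u '' (σ : Set (Fin n))) := by
    rw [eventually_all_finite hZ]
    intro z _
    rw [eventually_all]
    intro σ
    rw [eventually_imp_distrib_left]
    exact eventually_add_perturbation_notMem u J _ _
  let T : (Fin n → ℝ) → (Fin d → ℝ) × ℝ := fun c => ∑ i, c i • u i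
  let C : Set ((Fin d → ℝ) × ℝ) :=
    T '' (Set.Icc 0 (fun _ => (H : ℝ) + 1) ∩ {c | ∀ i ∉ K, c i = 0})
  have hC : IsClosed C := by
    refine IsCompact.isClosed (IsCompact.image (isCompact_Icc.inter_right ?_) ?_)
    · simp only [Set.ofPred_forall]
      exact isClosed_iInter fun i => isClosed_iInter fun _ =>
        isClosed_eq (continuous_apply i) continuous_const
    · fun_prop
  have hclosed : ∀ᶠ η : ℝ in 𝓝[>] 0, ∀ z ∈ {z | ‖latticeEmb d z‖ ≤ R}, latticeEmb d z ∉ C →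
      latticeEmb d z + perturbation a J η ∉ C := by
    rw [eventually_all_finite hZ]
    intro z _
    rw [eventually_imp_distrib_left]
    intro hz
    have h1 : Tendsto (fun η => latticeEmb d z + perturbation a J η) (𝓝[>] 0)
        (𝓝 (latticeEmb d z)) := by
      simpa using (tendsto_perturbation a J).const_add (latticeEmb d z)
    exact h1.eventually (hC.isOpen_compl.mem_nhds hz)
  filter_upwards [hnorm, hgen, hclosed, self_mem_nhdsWithin] with η hnorm hgen hclosed hη t htH
  have hη : 0 < η := hη
  set q := perturbation a J η with hq
  have hq2 : |q.2| < 1 := (norm_snd_le q).trans_lt hnorm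
  have hnn : ∀ z ∈ shiftedCone (latticeEmb d) a K q, 0 ≤ z.2 := by
    intro z hz
    have h1 := (norm_le_of_mem_shiftedCone ha hz).1
    have h2 : (-1 : ℝ) < z.2 := by linarith [(abs_lt.1 hq2).2]
    have h3 : (-1 : ℤ) < z.2 := by exact_mod_cast h2
    omega
  have hbd : ∀ z ∈ shiftedCone (latticeEmb d) a K q, z.2 ≤ H → ‖latticeEmb d z‖ ≤ R := by
    intro z hz hzH
    refine (norm_le_of_mem_shiftedCone ha hz).2.trans ?_
    have h1 : (z.2 : ℝ) ≤ H := by exact_mod_cast hzH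
    have h2 := (abs_lt.1 hq2).2
    exact add_le_add (mul_le_mul_of_nonneg_right (by linarith)
      (Finset.sum_nonneg fun _ _ => norm_nonneg _)) hnorm.le
  refine Eq.trans ?_ (card_shiftedCone (latticeEmb d) (AddMonoidHom.snd _ _) a ha K q D t hnn
    (fun k => finite_shiftedCone_height ha K q k) ?_)
  · congr 1
    ext z
    simp only [Set.mem_ofPred_eq, AddMonoidHom.coe_snd]
    rw [and_comm]
    refine and_congr_left fun hzt => ⟨?_, fun hz => ?_⟩
    · rintro ⟨c, h1, h2, h3⟩
      obtain ⟨c', h4, h5, h6⟩ := exists_isLexReduced_of_isUpperSet (u := u) hK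
        (fun i => c i + if i ∈ J then η ^ (i.1 + 1) else 0)
        (fun i => add_nonneg (h1 i) (by split_ifs <;> positivity))
        (fun i hi => by
          have : i ∉ J := fun h => hi (hJK h)
          simp [h2 i hi, this])
      refine ⟨c', h4, h5, h6.trans ?_⟩
      simp only [add_smul, Finset.sum_add_distrib, ite_smul, zero_smul, Finset.sum_ite_mem,
        Finset.univ_inter]
      exact congrArg₂ (· + ·) h3 rfl
    · have hzH : z.2 ≤ H := by rw [hzt]; exact_mod_cast htH
      have hzR := hbd z hz hzH
      have h1 : latticeEmb d z ∈ C := by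
        by_contra hcon
        refine hclosed z hzR hcon ?_
        obtain ⟨c, h1, h2, h3⟩ := hz
        refine ⟨c, ⟨⟨h1.1, fun i => ?_⟩, h2⟩, h3⟩
        have h4 : ∑ i, c i = z.2 + q.2 := sum_eq_of_combination ha h3
        have h5 := Finset.single_le_sum (fun j _ => h1.1 j) (Finset.mem_univ i)
        have h6 : (z.2 : ℝ) ≤ H := by exact_mod_cast hzH
        have h7 := (abs_lt.1 hq2).2
        change c i ≤ (H : ℝ) + 1
        linarith
      obtain ⟨c, ⟨⟨h2, -⟩, h3⟩, h4⟩ := h1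
      exact ⟨c, h2, h3, h4⟩
  · intro z hz hzt c h1 h2 h3
    have hzt' : z.2 ≤ (t : ℤ) := hzt
    have hzH : z.2 ≤ H := hzt'.trans (by exact_mod_cast htH)
    rw [← hD]
    refine h1.card_support_eq h2 hspan fun σ hσ => ?_
    rw [h3]
    exact hgen z (hbd z hz hzH) σ hσ

end Perturbation

section Ehrhart

theorem finrank_span_prodMk_one {E : Type*} [AddCommGroup E] [Module ℝ E] [FiniteDimensional ℝ E]
    {s : Set E} (hs : s.Nonempty) :
    Module.finrank ℝ (Submodule.span ℝ ((fun x => (x, (1 : ℝ))) '' s)) =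
      Module.finrank ℝ (vectorSpan ℝ s) + 1 := by
  obtain ⟨x₀, hx₀⟩ := hs
  have hsub : ∀ x ∈ vectorSpan ℝ s,
      (x, (0 : ℝ)) ∈ Submodule.span ℝ ((fun x => (x, (1 : ℝ))) '' s) := by
    intro x hx
    have h1 : vectorSpan ℝ s ≤ (Submodule.span ℝ ((fun x => (x, (1 : ℝ))) '' s)).comap
        (LinearMap.inl ℝ E ℝ) := by
      refine Submodule.span_le.2 ?_
      rintro _ ⟨y, hy, z, hz, rfl⟩
      have := Submodule.sub_mem _
        (Submodule.subset_span (R := ℝ) (Set.mem_image_of_mem (fun x => (x, (1 : ℝ))) hy))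
        (Submodule.subset_span (R := ℝ) (Set.mem_image_of_mem (fun x => (x, (1 : ℝ))) hz))
      simpa using this
    exact h1 hx
  have hsup : Submodule.span ℝ ((fun x => (x, (1 : ℝ))) '' s) =
      (vectorSpan ℝ s).map (LinearMap.inl ℝ E ℝ) ⊔ Submodule.span ℝ {(x₀, (1 : ℝ))} := by
    refine le_antisymm (Submodule.span_le.2 ?_) (sup_le ?_ ?_)
    · rintro _ ⟨x, hx, rfl⟩
      have h1 : (x - x₀, (0 : ℝ)) + (x₀, (1 : ℝ)) = (x, (1 : ℝ)) := by simp
      beta_reduce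
      rw [← h1]
      exact Submodule.add_mem_sup ⟨x - x₀, vsub_mem_vectorSpan ℝ hx hx₀, rfl⟩
        (Submodule.mem_span_singleton_self _)
    · rintro _ ⟨x, hx, rfl⟩
      exact hsub x hx
    · rw [Submodule.span_singleton_le_iff_mem]
      exact Submodule.subset_span ⟨x₀, hx₀, rfl⟩
  have hinf : (vectorSpan ℝ s).map (LinearMap.inl ℝ E ℝ) ⊓ Submodule.span ℝ {(x₀, (1 : ℝ))} = ⊥ := by
    rw [eq_bot_iff]
    rintro y ⟨⟨x, -, rfl⟩, hy⟩
    obtain ⟨r, hr⟩ := Submodule.mem_span_singleton.1 hy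
    have h2 : r = 0 := by simpa using congrArg Prod.snd hr
    rw [Submodule.mem_bot, ← hr, h2, zero_smul]
  have h3 := Submodule.finrank_sup_add_finrank_inf_eq
    ((vectorSpan ℝ s).map (LinearMap.inl ℝ E ℝ)) (Submodule.span ℝ {(x₀, (1 : ℝ))})
  rw [hinf, finrank_bot, add_zero, finrank_span_singleton (by simp),
    ← (Submodule.equivMapOfInjective _ LinearMap.inl_injective (vectorSpan ℝ s)).finrank_eq] at h3
  rw [hsup, h3]

theorem mem_convexHull_image_iff {ι E : Type*} [Fintype ι] [AddCommGroup E] [Module ℝ E]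
    (b : ι → E) (K : Finset ι) (x : E) :
    x ∈ convexHull ℝ (b '' K) ↔ ∃ w : ι → ℝ, (∀ i, 0 ≤ w i) ∧ (∀ i ∉ K, w i = 0) ∧
      ∑ i, w i = 1 ∧ ∑ i, w i • b i = x := by
  classical
  constructor
  · intro hx
    let S : Set E := {x | ∃ w : ι → ℝ, (∀ i, 0 ≤ w i) ∧ (∀ i ∉ K, w i = 0) ∧
      ∑ i, w i = 1 ∧ ∑ i, w i • b i = x}
    have hS : Convex ℝ S := by
      rintro _ ⟨w, h1, h2, h3, rfl⟩ _ ⟨w', h1', h2', h3', rfl⟩ r r' hr hr' hrr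
      refine ⟨fun i => r * w i + r' * w' i, fun i => ?_, fun i hi => ?_, ?_, ?_⟩
      · exact add_nonneg (mul_nonneg hr (h1 i)) (mul_nonneg hr' (h1' i))
      · simp [h2 i hi, h2' i hi]
      · rw [Finset.sum_add_distrib, ← Finset.mul_sum, ← Finset.mul_sum, h3, h3']
        simpa using hrr
      · simp only [add_smul, Finset.sum_add_distrib, mul_smul, Finset.smul_sum]
    refine convexHull_min ?_ hS hx
    rintro _ ⟨i, hi, rfl⟩
    refine ⟨Pi.single i 1, fun j => ?_, fun j hj => ?_, by simp, ?_⟩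
    · by_cases h : j = i
      · subst h; simp
      · simp [h]
    · have : j ≠ i := fun h => hj (h ▸ hi)
      simp [this]
    · rw [Finset.sum_eq_single i] <;> simp +contextual
  · rintro ⟨w, h1, h2, h3, rfl⟩
    rw [← Finset.sum_subset (Finset.subset_univ K) fun i _ hi => h2 i hi] at h3
    rw [← Finset.sum_subset (Finset.subset_univ K) fun i _ hi => by simp [h2 i hi]]
    exact (convex_convexHull ℝ _).sum_mem (fun i _ => h1 i) h3
      fun i hi => subset_convexHull ℝ _ ⟨i, hi, rfl⟩

theorem ehr_convexHull {d n : ℕ} {a : Fin n → (Fin d → ℤ) × ℤ} (ha : ∀ i, (a i).2 = 1)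
    {K : Finset (Fin n)} (hK : K.Nonempty) (t : ℕ) :
    ehr (convexHull ℝ ((fun i => intCast (a i).1) '' (K : Set (Fin n)))) t =
      {z : (Fin d → ℤ) × ℤ | z.2 = t ∧ ∃ c : Fin n → ℝ, (∀ i, 0 ≤ c i) ∧ (∀ i ∉ K, c i = 0) ∧
        ∑ i, c i • latticeEmb d (a i) = latticeEmb d z}.ncard := by
  rw [ehr, ← Set.ncard_image_of_injective (f := fun z : Fin d → ℤ => (z, (t : ℤ))) _
    fun x y h => congrArg Prod.fst h]
  congr 1
  have hsum : ∀ (c : Fin n → ℝ) (z : (Fin d → ℤ) × ℤ),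
      ∑ i, c i • latticeEmb d (a i) = latticeEmb d z ↔
        ∑ i, c i • intCast (a i).1 = intCast z.1 ∧ ∑ i, c i = z.2 := by
    intro c z
    rw [Prod.ext_iff, Prod.fst_sum, Prod.snd_sum]
    simp [latticeEmb_apply, ha]
  ext ⟨z, m⟩
  simp only [Set.mem_image, Set.mem_ofPred_eq, Prod.mk.injEq, hsum, mem_convexHull_image_iff]
  constructor
  · rintro ⟨z, ⟨x, ⟨w, h1, h2, h3, rfl⟩, hx⟩, rfl, rfl⟩
    refine ⟨rfl, fun i => t * w i, fun i => mul_nonneg (Nat.cast_nonneg _) (h1 i),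
      fun i hi => by simp [h2 i hi], ?_, ?_⟩
    · rw [← hx, Finset.smul_sum]
      simp only [mul_smul]
    · rw [← Finset.mul_sum, h3]
      simp
  · rintro ⟨rfl, c, h1, h2, h3, h4⟩
    refine ⟨z, ?_, rfl, rfl⟩
    rcases Nat.eq_zero_or_pos t with rfl | ht
    · have hc : ∀ i, c i = 0 := fun i =>
        (Finset.sum_eq_zero_iff_of_nonneg fun i _ => h1 i).1 (by simpa using h4) i
          (Finset.mem_univ i)
      obtain ⟨k, hk⟩ := hK
      refine ⟨intCast (a k).1, (mem_convexHull_image_iff (fun i => intCast (a i).1) K _).1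
        (subset_convexHull ℝ _ ⟨k, hk, rfl⟩), ?_⟩
      rw [← h3]
      simp [hc]
    · have ht' : (t : ℝ) ≠ 0 := by positivity
      refine ⟨(t : ℝ)⁻¹ • intCast z, ⟨fun i => (t : ℝ)⁻¹ * c i, fun i => ?_, fun i hi => ?_, ?_, ?_⟩, ?_⟩
      · exact mul_nonneg (by positivity) (h1 i)
      · simp [h2 i hi]
      · rw [← Finset.mul_sum, h4]
        simp [ht']
      · rw [← h3, Finset.smul_sum]
        simp only [mul_smul]
      · simp [smul_smul, ht']

theorem hstar_eq_coeff {d : ℕ} (P : Set (Fin d → ℝ)) (i : ℕ) :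
    hstar P i = PowerSeries.coeff i ((1 - PowerSeries.X) ^ (polyDim P + 1) *
      PowerSeries.mk fun t => (ehr P t : ℤ)) := by
  have hcoeff : ∀ m k : ℕ, PowerSeries.coeff k ((1 - PowerSeries.X : PowerSeries ℤ) ^ m) =
      (-1) ^ k * (m.choose k : ℤ) := by
    intro m k
    have h : (1 - PowerSeries.X : PowerSeries ℤ) ^ m =
        PowerSeries.rescale (-1) (((1 + Polynomial.X) ^ m : Polynomial ℤ) : PowerSeries ℤ) := by
      simp [sub_eq_add_neg, PowerSeries.rescale_X]
    rw [h, PowerSeries.coeff_rescale, Polynomial.coeff_coe, Polynomial.coeff_one_add_X_pow]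
  rw [PowerSeries.coeff_mul, hstar, Finset.Nat.sum_antidiagonal_eq_sum_range_succ_mk,
    ← Finset.sum_range_reflect]
  refine Finset.sum_congr rfl fun j hj => ?_
  have hj' : j ≤ i := Nat.lt_succ_iff.1 (Finset.mem_range.1 hj)
  rw [hcoeff, PowerSeries.coeff_mk]
  rw [show i + 1 - 1 - j = i - j by omega, show i - (i - j) = j by omega]

theorem hstar_eq_of_ehr_eq {d : ℕ} {P : Set (Fin d → ℝ)} {B : ℕ → ℕ} {T : ℕ}
    (h : ∀ t ≤ T, ehr P t =
      ∑ k ∈ Finset.range (t + 1), B k * (polyDim P + (t - k)).choose (polyDim P))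
    {i : ℕ} (hi : i ≤ T) : hstar P i = B i := by
  set D := polyDim P with hD
  let F : PowerSeries ℤ := PowerSeries.mk fun t => (ehr P t : ℤ)
  let G : PowerSeries ℤ := PowerSeries.mk fun t => (B t : ℤ)
  let I : PowerSeries ℤ := PowerSeries.mk fun t => ((D + t).choose D : ℤ)
  have hI : I * (1 - PowerSeries.X) ^ (D + 1) = 1 :=
    PowerSeries.mk_add_choose_mul_one_sub_pow_eq_one ℤ D
  have hF : ∀ t ≤ T, PowerSeries.coeff t F = PowerSeries.coeff t (G * I) := by
    intro t ht
    rw [PowerSeries.coeff_mul, Finset.Nat.sum_antidiagonal_eq_sum_range_succ_mk,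
      PowerSeries.coeff_mk, h t ht]
    simp [G, I]
  have h1 : PowerSeries.coeff i ((1 - PowerSeries.X) ^ (D + 1) * F) =
      PowerSeries.coeff i ((1 - PowerSeries.X) ^ (D + 1) * (G * I)) := by
    rw [PowerSeries.coeff_mul, PowerSeries.coeff_mul]
    refine Finset.sum_congr rfl fun p hp => ?_
    have := Finset.HasAntidiagonal.mem_antidiagonal.1 hp
    rw [hF p.2 (by omega)]
  rw [hstar_eq_coeff, ← hD, h1, mul_left_comm, mul_comm _ I, hI, mul_one, PowerSeries.coeff_mk]

end Ehrhart

section Monotonicity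

open Filter Topology

theorem polyDim_convexHull {d : ℕ} (s : Set (Fin d → ℝ)) :
    polyDim (convexHull ℝ s) = Module.finrank ℝ (vectorSpan ℝ s) := by
  rw [polyDim, ← direction_affineSpan, affineSpan_convexHull, direction_affineSpan]

variable {d n : ℕ} {a : Fin n → (Fin d → ℤ) × ℤ}

theorem finrank_span_latticeEmb (ha : ∀ i, (a i).2 = 1) {K : Finset (Fin n)} (hK : K.Nonempty) :
    Module.finrank ℝ (Submodule.span ℝ ((fun i => latticeEmb d (a i)) '' (K : Set (Fin n)))) =
      polyDim (convexHull ℝ ((fun i => intCast (a i).1) '' (K : Set (Fin n)))) + 1 := by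
  have h : (fun i => latticeEmb d (a i)) = fun i => (intCast (a i).1, (1 : ℝ)) :=
    funext fun i => by rw [latticeEmb_apply, ha, Int.cast_one]
  rw [polyDim_convexHull, ← finrank_span_prodMk_one (hK.to_set.image _), Set.image_image, h]

theorem eventually_hstar_eq_card_boxPoints (ha : ∀ i, (a i).2 = 1) {J K : Finset (Fin n)}
    (hJK : J ⊆ K) (hK : IsUpperSet (K : Set (Fin n))) (hne : K.Nonempty)
    (hspan : Submodule.span ℝ ((fun i => latticeEmb d (a i)) '' K) =
      Submodule.span ℝ ((fun i => latticeEmb d (a i)) '' J)) (i : ℕ) :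
    ∀ᶠ η : ℝ in 𝓝[>] 0, hstar (convexHull ℝ ((fun i => intCast (a i).1) '' (K : Set (Fin n)))) i =
      {z ∈ boxPoints (latticeEmb d) a K (perturbation a J η) | z.2 = i}.ncard := by
  have hD := finrank_span_latticeEmb ha hne
  rw [hspan] at hD
  filter_upwards [eventually_card_shiftedCone ha hJK hK hspan hD i] with η hη
  exact hstar_eq_of_ehr_eq (B := fun k => Set.ncard {z ∈ boxPoints (latticeEmb d) a K
    (perturbation a J η) | z.2 = k}) (fun t ht => (ehr_convexHull ha hne t).trans (hη t ht)) le_rfl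

theorem boxPoints_subset_shiftedCone (K : Set (Fin n)) (q : (Fin d → ℝ) × ℝ) :
    boxPoints (latticeEmb d) a K q ⊆ shiftedCone (latticeEmb d) a K q :=
  fun _ ⟨c, h1, h2, h3, _⟩ => ⟨c, h1, h2, h3⟩

theorem apply_eq_zero_of_notMem_span {ι E : Type*} [Fintype ι] [DecidableEq ι] [AddCommGroup E]
    [Module ℝ E] {u : ι → E} {i₀ : ι}
    (h : u i₀ ∉ Submodule.span ℝ (u '' (Finset.univ.erase i₀ : Finset ι))) {r : ι → ℝ}
    (hr : ∑ i, r i • u i = 0) : r i₀ = 0 := by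
  by_contra hne
  rw [← Finset.add_sum_erase _ _ (Finset.mem_univ i₀)] at hr
  refine h (((Submodule.span ℝ _).smul_mem_iff hne).1 ?_)
  rw [eq_neg_of_add_eq_zero_left hr]
  exact Submodule.neg_mem _ (Submodule.sum_mem _ fun i hi =>
    Submodule.smul_mem _ _ (Submodule.subset_span ⟨i, hi, rfl⟩))

theorem boxPoints_subset_insert {a : Fin (n + 1) → (Fin d → ℤ) × ℤ} {η : ℝ} (hη : 0 < η)
    (hη1 : η ≤ 1)
    (h : latticeEmb d (a 0) ∉ Submodule.span ℝ ((fun i => latticeEmb d (a i)) ''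
      (Finset.univ.erase 0 : Finset (Fin (n + 1))))) :
    boxPoints (latticeEmb d) a (Finset.univ.erase 0 : Finset (Fin (n + 1)))
        (perturbation a (Finset.univ.erase 0) η) ⊆
      boxPoints (latticeEmb d) a (Finset.univ : Finset (Fin (n + 1)))
        (perturbation a Finset.univ η) := by
  rintro z ⟨c, h1, h2, h3, h4⟩
  have hc0 : c 0 = 0 := h2 0 (by simp)
  refine ⟨Function.update c 0 η, ⟨fun i => ?_, fun r hr hlt => ?_⟩, by simp, ?_, fun i => ?_⟩
  · rcases eq_or_ne i 0 with rfl | hi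
    · simpa using hη.le
    · simpa [hi] using h1.1 i
  · obtain ⟨i, hi, hi'⟩ := h1.2 r hr hlt
    have hr0 := apply_eq_zero_of_notMem_span (u := fun i => latticeEmb d (a i)) h hr
    have hi0 : i ≠ 0 := fun h0 => by simp [h0, hr0] at hi
    exact ⟨i, hi, by simpa [hi0] using hi'⟩
  · rw [← Finset.add_sum_erase _ _ (Finset.mem_univ 0)] at h3 ⊢
    rw [perturbation, ← Finset.add_sum_erase _ _ (Finset.mem_univ 0), ← perturbation]
    rw [hc0, zero_smul, zero_add] at h3
    rw [Finset.sum_congr rfl fun i hi => by rw [Function.update_of_ne (Finset.ne_of_mem_erase hi)],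
      h3]
    simp only [Function.update_self, Fin.val_zero, zero_add, pow_one]
    abel
  · rcases eq_or_ne i 0 with rfl | hi
    · simpa using hη1
    · simpa [hi] using h4 i

theorem isUpperSet_univ_erase_zero :
    IsUpperSet ((Finset.univ.erase 0 : Finset (Fin (n + 1))) : Set (Fin (n + 1))) := by
  intro i j hij hi
  simp only [Finset.coe_erase, Finset.coe_univ, Set.mem_sdiff, Set.mem_univ, true_and,
    Set.mem_singleton_iff] at hi ⊢
  rintro rfl
  exact hi (le_antisymm hij (Fin.zero_le _))

theorem hstar_le_hstar_univ {a : Fin (n + 1) → (Fin d → ℤ) × ℤ} (ha : ∀ i, (a i).2 = 1)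
    (hn : 0 < n) (i : ℕ) :
    0 ≤ hstar (convexHull ℝ ((fun i => intCast (a i).1) ''
        ((Finset.univ.erase 0 : Finset (Fin (n + 1))) : Set (Fin (n + 1))))) i ∧
      hstar (convexHull ℝ ((fun i => intCast (a i).1) ''
        ((Finset.univ.erase 0 : Finset (Fin (n + 1))) : Set (Fin (n + 1))))) i ≤
      hstar (convexHull ℝ ((fun i => intCast (a i).1) ''
        ((Finset.univ : Finset (Fin (n + 1))) : Set (Fin (n + 1))))) i := by
  have hne : (Finset.univ.erase 0 : Finset (Fin (n + 1))).Nonempty :=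
    ⟨Fin.last n, by simp [Fin.ext_iff, hn.ne']⟩
  have h1 := eventually_hstar_eq_card_boxPoints ha Subset.rfl isUpperSet_univ_erase_zero hne rfl i
  have hη : ∀ᶠ η : ℝ in 𝓝[>] 0, 0 < η ∧ η ≤ 1 := by
    filter_upwards [Ioc_mem_nhdsGT (zero_lt_one' ℝ)] with η hη using hη
  by_cases h : latticeEmb d (a 0) ∈ Submodule.span ℝ ((fun i => latticeEmb d (a i)) ''
      (Finset.univ.erase 0 : Finset (Fin (n + 1))))
  · have hspan : Submodule.span ℝ ((fun i => latticeEmb d (a i)) ''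
        ((Finset.univ : Finset (Fin (n + 1))) : Set (Fin (n + 1)))) =
        Submodule.span ℝ ((fun i => latticeEmb d (a i)) ''
          (Finset.univ.erase 0 : Finset (Fin (n + 1)))) := by
      refine le_antisymm (Submodule.span_le.2 ?_)
        (Submodule.span_mono (Set.image_mono (by simp)))
      rintro _ ⟨j, -, rfl⟩
      rcases eq_or_ne j 0 with rfl | hj
      · exact h
      · exact Submodule.subset_span ⟨j, by simpa using hj, rfl⟩
    have h2 := eventually_hstar_eq_card_boxPoints ha (Finset.erase_subset 0 _)
      (by simpa using isUpperSet_univ) Finset.univ_nonempty hspan i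
    obtain ⟨η, h1, h2⟩ := (h1.and h2).exists
    rw [h1, h2]
    refine ⟨by positivity, Nat.cast_le.2 (Set.ncard_le_ncard ?_
      ((finite_shiftedCone_height ha _ _ _).subset
        fun z hz => ⟨boxPoints_subset_shiftedCone _ _ hz.1, hz.2⟩))⟩
    rintro z ⟨⟨c, hc1, -, hc3⟩, hz⟩
    exact ⟨⟨c, hc1, by simp, hc3⟩, hz⟩
  · have h2 := eventually_hstar_eq_card_boxPoints ha Subset.rfl
      (by simpa using isUpperSet_univ) (Finset.univ_nonempty (α := Fin (n + 1))) rfl i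
    obtain ⟨η, ⟨h1, h2⟩, h3⟩ := ((h1.and h2).and hη).exists
    rw [h1, h2]
    exact ⟨by positivity, Nat.cast_le.2 (Set.ncard_le_ncard
      (fun z hz => ⟨boxPoints_subset_insert h3.1 h3.2 h hz.1, hz.2⟩)
      ((finite_shiftedCone_height ha _ _ _).subset
        fun z hz => ⟨boxPoints_subset_shiftedCone _ _ hz.1, hz.2⟩))⟩

theorem hstar_le_hstar_insert {V : Finset (Fin d → ℤ)} (hV : V.Nonempty) (v : Fin d → ℤ) (i : ℕ) :
    0 ≤ hstar (convexHull ℝ (intCast '' (V : Set (Fin d → ℤ)))) i ∧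
      hstar (convexHull ℝ (intCast '' (V : Set (Fin d → ℤ)))) i ≤
        hstar (convexHull ℝ (intCast '' (insert v V : Set (Fin d → ℤ)))) i := by
  let e : Fin V.card → Fin d → ℤ := fun j => V.equivFin.symm j
  have he : Set.range e = V := by
    change Set.range (Subtype.val ∘ V.equivFin.symm) = _
    rw [V.equivFin.symm.surjective.range_comp]
    simp
  let a : Fin (V.card + 1) → (Fin d → ℤ) × ℤ := fun j => ((Fin.cons v e : Fin (V.card + 1) → _) j, 1)
  have h := hstar_le_hstar_univ (a := a) (fun _ => rfl) hV.card_pos i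
  have h1 : (fun j => intCast (a j).1) '' ((Finset.univ : Finset (Fin (V.card + 1))) :
      Set (Fin (V.card + 1))) = intCast '' (insert v V : Set (Fin d → ℤ)) := by
    rw [← he, ← Fin.range_cons, ← Set.range_comp]
    simp [a, Function.comp_def]
  have h2 : (fun j => intCast (a j).1) '' ((Finset.univ.erase 0 : Finset (Fin (V.card + 1))) :
      Set (Fin (V.card + 1))) = intCast '' (V : Set (Fin d → ℤ)) := by
    rw [← he, ← Set.range_comp]
    ext x
    simp only [Set.mem_image, Set.mem_range, Finset.mem_coe, Finset.mem_erase, Finset.mem_univ,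
      and_true]
    constructor
    · rintro ⟨j, hj, rfl⟩
      obtain ⟨k, rfl⟩ := Fin.exists_succ_eq.2 hj
      exact ⟨k, by simp [a]⟩
    · rintro ⟨k, rfl⟩
      exact ⟨k.succ, Fin.succ_ne_zero k, by simp [a]⟩
  rwa [h1, h2] at h

theorem hstar_nonneg {P : Set (Fin d → ℝ)} (hP : IsLatticePolytope P) (i : ℕ) : 0 ≤ hstar P i := by
  obtain ⟨V, hV, rfl⟩ := hP
  exact (hstar_le_hstar_insert hV 0 i).1

theorem hstar_mono {P Q : Set (Fin d → ℝ)} (hP : IsLatticePolytope P) (hQ : IsLatticePolytope Q)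
    (hPQ : P ⊆ Q) (i : ℕ) : hstar P i ≤ hstar Q i := by
  obtain ⟨V, hV, rfl⟩ := hP
  obtain ⟨W, -, rfl⟩ := hQ
  have key : ∀ W : Finset (Fin d → ℤ), hstar (convexHull ℝ (intCast '' (V : Set (Fin d → ℤ)))) i ≤
      hstar (convexHull ℝ (intCast '' ((W ∪ V : Finset (Fin d → ℤ)) : Set (Fin d → ℤ)))) i := by
    intro W
    induction W using Finset.induction_on with
    | empty => simp
    | insert w W _ ih =>
      refine ih.trans ?_
      have := (hstar_le_hstar_insert (hV.mono Finset.subset_union_right : (W ∪ V).Nonempty) w i).2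
      rwa [Finset.insert_union, Finset.coe_insert]
  have hunion : convexHull ℝ (intCast '' ((W ∪ V : Finset (Fin d → ℤ)) : Set (Fin d → ℤ))) =
      convexHull ℝ (intCast '' (W : Set (Fin d → ℤ))) := by
    refine Set.Subset.antisymm (convexHull_min ?_ (convex_convexHull ℝ _))
      (convexHull_mono (Set.image_mono (by simp)))
    rw [Finset.coe_union, Set.image_union]
    exact Set.union_subset (subset_convexHull ℝ _) ((subset_convexHull ℝ _).trans hPQ)
  exact hunion ▸ key W

end Monotonicity

section Crosspolytope

/-- The crosspolytope, the unit ball of the `ℓ¹`-norm. -/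
def crosspolytope (d : ℕ) : Set (Fin d → ℝ) := {x | ∑ i, |x i| ≤ 1}

/-- The integer vectors of `ℓ¹`-norm at most `t`. -/
noncomputable def intBall (d t : ℕ) : Finset (Fin d → ℤ) :=
  (Fintype.piFinset fun _ => Finset.Icc (-t : ℤ) t).filter fun z => ∑ i, (z i).natAbs ≤ t

theorem mem_intBall {d t : ℕ} {z : Fin d → ℤ} : z ∈ intBall d t ↔ ∑ i, (z i).natAbs ≤ t := by
  simp only [intBall, Finset.mem_filter, Fintype.mem_piFinset, Finset.mem_Icc, and_iff_right_iff_imp]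
  intro h i
  have := (Finset.single_le_sum (f := fun i => (z i).natAbs) (fun _ _ => Nat.zero_le _)
    (Finset.mem_univ i)).trans h
  omega

theorem card_intBall_succ (d t : ℕ) : (intBall (d + 1) t).card =
    ∑ p ∈ Finset.HasAntidiagonal.antidiagonal t,
      (if p.1 = 0 then 1 else 2) * (intBall d p.2).card := by
  have hmem : ∀ z ∈ intBall (d + 1) t, ((z 0).natAbs, t - (z 0).natAbs) ∈
      Finset.HasAntidiagonal.antidiagonal t := by
    intro z hz
    rw [mem_intBall, Fin.sum_univ_succ] at hz
    rw [Finset.HasAntidiagonal.mem_antidiagonal]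
    omega
  rw [Finset.card_eq_sum_card_fiberwise hmem]
  refine Finset.sum_congr rfl fun p hp => ?_
  rw [Finset.HasAntidiagonal.mem_antidiagonal] at hp
  have hc : (if p.1 = 0 then 1 else 2) = ({(p.1 : ℤ), -(p.1 : ℤ)} : Finset ℤ).card := by
    split_ifs with h
    · simp [h]
    · rw [Finset.card_pair (by omega)]
  rw [hc, ← Finset.card_product]
  refine Finset.card_nbij' (fun z => (z 0, Fin.tail z)) (fun x => Fin.cons x.1 x.2) ?_ ?_ ?_ ?_
  · intro z hz
    simp only [Finset.coe_filter, Set.mem_ofPred_eq, mem_intBall, Fin.sum_univ_succ,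
      Prod.ext_iff] at hz
    simp only [Finset.coe_product, Set.mem_prod, Finset.mem_coe, Finset.mem_insert,
      Finset.mem_singleton, mem_intBall, Fin.tail]
    omega
  · rintro ⟨m, z⟩ hz
    simp only [Finset.coe_product, Set.mem_prod, Finset.mem_coe, Finset.mem_insert,
      Finset.mem_singleton, mem_intBall] at hz
    simp only [Finset.coe_filter, Set.mem_ofPred_eq, mem_intBall, Fin.sum_univ_succ,
      Prod.ext_iff, Fin.cons_zero, Fin.cons_succ]
    omega
  · intro z _
    exact Fin.cons_self_tail z
  · rintro ⟨m, z⟩ _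
    simp

theorem mk_card_intBall (d : ℕ) :
    (1 - PowerSeries.X) ^ (d + 1) * (PowerSeries.mk fun t => ((intBall d t).card : ℤ)) =
      (1 + PowerSeries.X) ^ d := by
  induction d with
  | zero =>
    have h : ∀ t, intBall 0 t = Finset.univ := fun t => by
      exact Finset.eq_univ_of_forall fun z => by simp [mem_intBall]
    simp only [h]
    simp only [Finset.univ_unique, Finset.card_singleton, Nat.cast_one, zero_add, pow_one, pow_zero]
    exact (mul_comm _ _).trans (PowerSeries.mk_one_mul_one_sub_eq_one ℤ)
  | succ d ih =>
    let C : PowerSeries ℤ := PowerSeries.mk fun p => if p = 0 then 1 else 2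
    have hC : (1 - PowerSeries.X) * C = 1 + PowerSeries.X := by
      ext n
      rw [sub_mul, one_mul, map_sub, map_add]
      rcases n with _ | _ | n <;>
        simp [C, PowerSeries.coeff_succ_X_mul, PowerSeries.coeff_X, PowerSeries.coeff_one]
    have hN : (PowerSeries.mk fun t => ((intBall (d + 1) t).card : ℤ)) =
        C * PowerSeries.mk fun t => ((intBall d t).card : ℤ) := by
      ext t
      simp [PowerSeries.coeff_mul, card_intBall_succ, C]
    rw [hN, pow_succ (1 + PowerSeries.X), ← ih, ← hC]
    ring

theorem ehr_crosspolytope (d t : ℕ) : ehr (crosspolytope d) t = (intBall d t).card := by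
  rw [ehr, ← Set.ncard_coe_finset]
  congr 1
  ext z
  have hz : (z ∈ intBall d t) ↔ ∑ i, |(z i : ℝ)| ≤ t := by
    rw [mem_intBall, ← Nat.cast_le (α := ℝ)]
    simp [Nat.cast_natAbs]
  rw [Finset.mem_coe, hz]
  constructor
  · rintro ⟨x, hx, h⟩
    have h' : ∀ i, (z i : ℝ) = t * x i := fun i => (congrFun h i).symm
    simp only [h', abs_mul, ← Finset.mul_sum, Nat.abs_cast]
    exact mul_le_of_le_one_right (Nat.cast_nonneg t) hx
  · intro h
    rcases Nat.eq_zero_or_pos t with rfl | ht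
    · have h0 : ∀ i, |(z i : ℝ)| = 0 := fun i =>
        (Finset.sum_eq_zero_iff_of_nonneg fun i _ => abs_nonneg _).1
          (le_antisymm (by simpa using h) (Finset.sum_nonneg fun i _ => abs_nonneg _)) i
          (Finset.mem_univ i)
      refine ⟨0, by simp [crosspolytope], ?_⟩
      ext i
      simpa [intCast] using (abs_eq_zero.1 (h0 i)).symm
    · have ht' : (0 : ℝ) < t := by exact_mod_cast ht
      refine ⟨(t : ℝ)⁻¹ • intCast z, ?_, by simp [smul_smul, ht'.ne']⟩
      change ∑ i, |(t : ℝ)⁻¹ * (z i : ℝ)| ≤ 1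
      simp only [abs_mul, ← Finset.mul_sum, abs_inv, Nat.abs_cast]
      exact inv_mul_le_one_of_le₀ h ht'.le

theorem abs_single_mem_crosspolytope {d : ℕ} (i : Fin d) {s : ℝ} (hs : |s| ≤ 1) :
    Pi.single i s ∈ crosspolytope d := by
  change ∑ j, |(Pi.single i s : Fin d → ℝ) j| ≤ 1
  rw [Finset.sum_eq_single i] <;> simp +contextual [hs]

theorem polyDim_crosspolytope (d : ℕ) : polyDim (crosspolytope d) = d := by
  have h : vectorSpan ℝ (crosspolytope d) = ⊤ := by
    rw [eq_top_iff]
    rintro x -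
    rw [← Finset.univ_sum_single x]
    refine Submodule.sum_mem _ fun i _ => ?_
    have := vsub_mem_vectorSpan ℝ (abs_single_mem_crosspolytope i (s := 1) (by simp))
      (abs_single_mem_crosspolytope i (s := 0) (by simp))
    simpa [← Pi.single_smul] using Submodule.smul_mem _ (x i) this
  rw [polyDim, h, finrank_top, Module.finrank_fin_fun]

theorem hstar_crosspolytope (d i : ℕ) : hstar (crosspolytope d) i = d.choose i := by
  rw [hstar_eq_coeff, polyDim_crosspolytope]
  simp only [ehr_crosspolytope]
  have h : (1 + PowerSeries.X : PowerSeries ℤ) ^ d =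
      (((1 + Polynomial.X) ^ d : Polynomial ℤ) : PowerSeries ℤ) := by simp
  rw [mk_card_intBall, h, Polynomial.coeff_coe, Polynomial.coeff_one_add_X_pow]

theorem crosspolytope_subset {d : ℕ} {K : Set (Fin d → ℝ)} (hK : Convex ℝ K) (h0 : 0 ∈ K)
    (h1 : ∀ i, Pi.single i 1 ∈ K) (h2 : ∀ i, Pi.single i (-1) ∈ K) : crosspolytope d ⊆ K := by
  intro x hx
  have key := hK.sum_mem (t := Finset.univ)
    (w := fun o : Option (Fin d) => o.elim (1 - ∑ i, |x i|) fun i => |x i|)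
    (z := fun o : Option (Fin d) => o.elim 0 fun i => Pi.single i (if 0 ≤ x i then 1 else -1))
    (by rintro (_ | i) - <;> simp; exact hx) (by simp [Fintype.sum_option])
    (by
      rintro (_ | i) -
      · exact h0
      · change Pi.single i _ ∈ K
        split_ifs
        exacts [h1 i, h2 i])
  rw [Fintype.sum_option] at key
  convert key using 1
  simp only [Option.elim_none, Option.elim_some, smul_zero, zero_add]
  conv_lhs => rw [← Finset.univ_sum_single x]
  refine Finset.sum_congr rfl fun i _ => ?_
  rw [← Pi.single_smul, smul_eq_mul]
  split_ifs with h
  · rw [abs_of_nonneg h, mul_one]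
  · rw [abs_of_neg (not_le.1 h), neg_mul_neg, mul_one]

theorem convex_crosspolytope (d : ℕ) : Convex ℝ (crosspolytope d) := by
  intro x hx y hy r s hr hs hrs
  have hx' : ∑ i, |x i| ≤ 1 := hx
  have hy' : ∑ i, |y i| ≤ 1 := hy
  calc ∑ i, |r * x i + s * y i| ≤ ∑ i, (r * |x i| + s * |y i|) :=
        Finset.sum_le_sum fun i _ => (abs_add_le _ _).trans
          (by rw [abs_mul, abs_mul, abs_of_nonneg hr, abs_of_nonneg hs])
    _ = r * ∑ i, |x i| + s * ∑ i, |y i| := by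
        rw [Finset.sum_add_distrib, Finset.mul_sum, Finset.mul_sum]
    _ ≤ 1 := by nlinarith

theorem intCast_single {d : ℕ} (i : Fin d) (m : ℤ) :
    intCast (Pi.single i m) = Pi.single i (m : ℝ) := by
  ext j
  rcases eq_or_ne j i with rfl | h <;> simp [intCast, *]

theorem isLatticePolytope_crosspolytope (d : ℕ) : IsLatticePolytope (crosspolytope d) := by
  let V : Finset (Fin d → ℤ) := insert 0 (Finset.univ.image (fun i => Pi.single i 1) ∪
    Finset.univ.image fun i => Pi.single i (-1))
  refine ⟨V, Finset.insert_nonempty _ _, Set.Subset.antisymm ?_ (convexHull_min ?_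
    (convex_crosspolytope d))⟩
  · have hV : ∀ v ∈ V, intCast v ∈ convexHull ℝ (intCast '' (V : Set (Fin d → ℤ))) :=
      fun v hv => subset_convexHull ℝ _ ⟨v, hv, rfl⟩
    refine crosspolytope_subset (convex_convexHull ℝ _) ?_ (fun i => ?_) fun i => ?_
    · convert hV 0 (by simp [V])
      ext; simp [intCast]
    · simpa [intCast_single] using hV (Pi.single i 1) (by simp [V])
    · simpa [intCast_single] using hV (Pi.single i (-1)) (by simp [V])
  · rintro _ ⟨v, hv, rfl⟩
    simp only [V, Finset.coe_insert, Finset.coe_union, Finset.coe_image, Finset.coe_univ,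
      Set.image_univ, Set.mem_insert_iff, Set.mem_union, Set.mem_range] at hv
    rcases hv with rfl | ⟨i, rfl⟩ | ⟨i, rfl⟩
    · simp [crosspolytope, intCast]
    · exact intCast_single i 1 ▸ abs_single_mem_crosspolytope i (by simp)
    · exact intCast_single i (-1) ▸ abs_single_mem_crosspolytope i (by simp)

end Crosspolytope

section Unconditional

theorem isLatticePolytope_cube (d : ℕ) : IsLatticePolytope (cube d) := by
  refine ⟨Fintype.piFinset fun _ => {-1, 1}, ⟨fun _ => 1, by simp⟩, ?_⟩
  have h : intCast '' ((Fintype.piFinset fun _ : Fin d => ({-1, 1} : Finset ℤ)) :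
      Set (Fin d → ℤ)) = Set.univ.pi fun _ => {-1, 1} := by
    ext x
    simp only [Set.mem_image, Finset.mem_coe, Fintype.mem_piFinset, Finset.mem_insert,
      Finset.mem_singleton, Set.mem_pi, Set.mem_univ, true_imp_iff, Set.mem_insert_iff,
      Set.mem_singleton_iff]
    constructor
    · rintro ⟨z, hz, rfl⟩ i
      rcases hz i with h | h <;> simp [intCast, h]
    · intro hx
      refine ⟨fun i => if x i = 1 then 1 else -1, fun i => ?_, funext fun i => ?_⟩
      · dsimp only
        split_ifs <;> simp
      · rcases hx i with h | h <;> norm_num [intCast, h]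
  rw [h, convexHull_pi]
  ext x
  simp [cube, convexHull_pair, segment_eq_Icc, abs_le, Pi.le_def, forall_and]

variable {d : ℕ} {P : Set (Fin d → ℝ)}

theorem Unconditional.subset_cube (hP : Unconditional P) (hb : Bornology.IsBounded P)
    {A : Finset (Fin d → ℤ)} (hA : P = {x | ∀ a ∈ A, dot (intCast a) x ≤ 1}) : P ⊆ cube d := by
  intro x hx i
  obtain ⟨a, haA, hai⟩ : ∃ a ∈ A, a i ≠ 0 := by
    by_contra! h
    obtain ⟨R, hR⟩ := hb.exists_norm_le
    have hmem : (Pi.single i (|R| + 1) : Fin d → ℝ) ∈ P := by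
      rw [hA]
      intro a ha
      simp [dot, intCast, Pi.single_apply, h a ha]
    have h1 := (norm_le_pi_norm _ i).trans (hR _ hmem)
    rw [Pi.single_eq_same, Real.norm_of_nonneg (by positivity)] at h1
    linarith [le_abs_self R]
  let σ : Fin d → ℝ := fun j => if 0 ≤ a j * x j then 1 else -1
  have hσ : IsSignVec σ := fun j => by
    simp only [σ]
    split_ifs <;> simp
  have h1 : sflip σ x ∈ P := hP σ hσ x hx
  rw [hA] at h1
  have h2 : ∑ j, |a j * x j| ≤ 1 := by
    refine le_of_eq_of_le (Finset.sum_congr rfl fun j _ => ?_) (h1 a haA)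
    simp only [intCast, sflip, σ]
    split_ifs with h
    · rw [abs_of_nonneg h, one_mul]
    · rw [abs_of_neg (not_le.1 h)]
      ring
  have h3 := (Finset.single_le_sum (f := fun j => |a j * x j|) (fun _ _ => abs_nonneg _)
    (Finset.mem_univ i)).trans h2
  rw [abs_mul] at h3
  have h4 : (1 : ℝ) ≤ |(a i : ℝ)| := by exact_mod_cast Int.one_le_abs hai
  exact (le_mul_of_one_le_left (abs_nonneg _) h4).trans h3

theorem Unconditional.crosspolytope_subset (hP : Unconditional P) (hL : IsLatticePolytope P)
    (h0 : 0 ∈ interior P) : crosspolytope d ⊆ P := by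
  have hconv : Convex ℝ P := by
    obtain ⟨V, -, rfl⟩ := hL
    exact convex_convexHull ℝ _
  have h0P := interior_subset h0
  have key : ∀ i, ∃ r : ℝ, 1 ≤ r ∧ Pi.single i r ∈ P ∧ Pi.single i (-r) ∈ P := by
    intro i
    obtain ⟨v, hvP, hvi⟩ : ∃ v : Fin d → ℤ, intCast v ∈ P ∧ v i ≠ 0 := by
      obtain ⟨V, -, rfl⟩ := hL
      by_contra! h
      have hsub : convexHull ℝ (intCast '' (V : Set (Fin d → ℤ))) ⊆
          {x : Fin d → ℝ | x i = 0} := by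
        refine convexHull_min ?_ (convex_hyperplane (LinearMap.proj i).isLinear 0)
        rintro _ ⟨v, hv, rfl⟩
        simpa [intCast] using h v (subset_convexHull ℝ _ ⟨v, hv, rfl⟩)
      have hcont : Filter.Tendsto (fun t : ℝ => (Pi.single i t : Fin d → ℝ)) (nhds 0) (nhds 0) := by
        have := (continuous_single (A := fun _ : Fin d => ℝ) i).tendsto 0
        rwa [Pi.single_zero] at this
      have hev := (hcont.eventually (mem_interior_iff_mem_nhds.1 h0)).filter_mono
        (nhdsWithin_le_nhds (s := Set.Ioi 0))
      obtain ⟨t, ht, ht0⟩ := (hev.and self_mem_nhdsWithin).exists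
      have : t = 0 := by simpa using hsub ht
      exact (ne_of_gt ht0) this
    have h1 : (Pi.single i (v i : ℝ) : Fin d → ℝ) ∈ P := by
      let σ : Fin d → ℝ := fun j => if j = i then 1 else -1
      have hσ : IsSignVec σ := fun j => by
        simp only [σ]
        split_ifs <;> simp
      have := hconv hvP (hP σ hσ _ hvP) (by norm_num : (0 : ℝ) ≤ 1 / 2)
        (by norm_num : (0 : ℝ) ≤ 1 / 2) (by norm_num)
      convert this using 1
      ext j
      rcases eq_or_ne j i with rfl | h
      · simp [σ, sflip, intCast]
        ring
      · simp [σ, sflip, intCast, h]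
    have h2 : (Pi.single i (-(v i : ℝ)) : Fin d → ℝ) ∈ P := by
      convert hP (fun _ => -1) (fun _ => .inr rfl) _ h1 using 1
      ext j
      rcases eq_or_ne j i with rfl | h <;> simp [sflip, *]
    refine ⟨|(v i : ℝ)|, by exact_mod_cast Int.one_le_abs hvi, ?_⟩
    rcases abs_choice (v i : ℝ) with h | h <;> rw [h]
    · exact ⟨h1, h2⟩
    · exact ⟨h2, by rwa [neg_neg]⟩
  have hscale : ∀ i (r s : ℝ), 1 ≤ r → Pi.single i (r * s) ∈ P → Pi.single i s ∈ P := by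
    intro i r s hr h
    have hr0 : r ≠ 0 := by positivity
    have := hconv.smul_mem_of_zero_mem h0P h (t := r⁻¹)
      ⟨by positivity, inv_le_one_of_one_le₀ hr⟩
    rwa [← Pi.single_smul, smul_eq_mul, inv_mul_cancel_left₀ hr0] at this
  refine _root_.crosspolytope_subset hconv h0P (fun i => ?_) fun i => ?_
  · obtain ⟨r, hr, h, -⟩ := key i
    exact hscale i r 1 hr (by rwa [mul_one])
  · obtain ⟨r, hr, -, h⟩ := key i
    exact hscale i r (-1) hr (by rwa [mul_neg_one])

end Unconditional

/-- monotonicity of `h^*`-vectors, and the resulting bounds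
`binom(d,i) ≤ h^*_i(P) ≤ B(d,i)` for unconditional reflexive polytopes. -/
theorem stmt14 (d : ℕ) :
    (∀ P Q : Set (Fin d → ℝ), IsLatticePolytope P → IsLatticePolytope Q → P ⊆ Q →
      ∀ i ≤ d, 0 ≤ hstar P i ∧ hstar P i ≤ hstar Q i) ∧
    (∀ P : Set (Fin d → ℝ), IsLatticePolytope P → Unconditional P → IsReflexive P →
      ∀ i ≤ d, (d.choose i : ℤ) ≤ hstar P i ∧ hstar P i ≤ hstar (cube d) i) := by
  refine ⟨fun P Q hP hQ hPQ i _ => ⟨hstar_nonneg hP i, hstar_mono hP hQ hPQ i⟩,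
    fun P hP hU hR i _ => ⟨?_, ?_⟩⟩
  · rw [← hstar_crosspolytope]
    exact hstar_mono (isLatticePolytope_crosspolytope d) hP (hU.crosspolytope_subset hP hR.1) i
  · obtain ⟨-, A, hA⟩ := hR
    refine hstar_mono hP (isLatticePolytope_cube d) (hU.subset_cube ?_ hA) i
    obtain ⟨V, -, rfl⟩ := hP
    exact ((V.finite_toSet.image _).isCompact_convexHull ℝ).isBounded
end
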